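/- arXiv:1507.04187 — 2 statements merged into one kernel-verified Lean document; each statement's English description precedes it below -/
import Mathlib

section
/- Let d ≥ 1 and let μ ∈ P_1(ℝ^d) be centered and not supported on an affine hyperplane (there is no e ∈ ℝ^d with |e| = 1 and ℓ ∈ ℝ such that μ({y : ⟨y,e⟩ = ℓ}) = 1). Then μ is a moment measure: there exists a convex, lower semicontinuous, proper, essentially continuous function u : ℝ^d → ℝ ∪ {+∞} such that ∫ e^{−u(x)} dx = 1 and μ is the pushforward of the probability measure with Lebesgue density e^{−u} under the a.e.-defined gradient ∇u. -/
open MeasureTheory Real Filter Topology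
open scoped ENNReal RealInnerProductSpace

noncomputable section

/-- `d`-dimensional Euclidean space. -/
abbrev Ed (d : ℕ) := EuclideanSpace ℝ (Fin d)

open Classical in
/-- The entropy `E(ρ) = ∫ f ln f dx` (extended-real-valued, computed as positive part minus
negative part of the integral of `f ln f`, where `f` is the density), and `+∞` if `ρ` is not
absolutely continuous w.r.t. Lebesgue measure. -/
def entropy {d : ℕ} (ρ : Measure (Ed d)) : EReal :=
  if ρ ≪ (volume : Measure (Ed d)) then
    ((∫⁻ x, ENNReal.ofReal ((ρ.rnDeriv volume x).toReal *
        Real.log (ρ.rnDeriv volume x).toReal) : ℝ≥0∞) : EReal)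
      - ((∫⁻ x, ENNReal.ofReal (-((ρ.rnDeriv volume x).toReal *
        Real.log (ρ.rnDeriv volume x).toReal)) : ℝ≥0∞) : EReal)
  else ⊤

/-- The (extended-real-valued) integral `∫ ⟨x,y⟩ dγ(x,y)`: positive part minus negative part. -/
def pairInt {d : ℕ} (γ : Measure (Ed d × Ed d)) : EReal :=
  ((∫⁻ p, ENNReal.ofReal (⟪p.1, p.2⟫ : ℝ) ∂γ : ℝ≥0∞) : EReal)
    - ((∫⁻ p, ENNReal.ofReal (-(⟪p.1, p.2⟫ : ℝ)) ∂γ : ℝ≥0∞) : EReal)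

/-- Transport plans: probability measures on the product with marginals `ρ` and `μ`. -/
def Couplings {d : ℕ} (ρ μ : Measure (Ed d)) : Set (Measure (Ed d × Ed d)) :=
  {γ | IsProbabilityMeasure γ ∧ γ.fst = ρ ∧ γ.snd = μ}

/-- The maximal correlation functional `T(ρ,μ) = sup { ∫⟨x,y⟩ dγ : γ ∈ Π(ρ,μ) }`. -/
def maxCorr {d : ℕ} (ρ μ : Measure (Ed d)) : EReal :=
  ⨆ γ ∈ Couplings ρ μ, pairInt γ

/-- `ρ` has finite first moment. -/
def FirstMoment {d : ℕ} (ρ : Measure (Ed d)) : Prop := Integrable (fun x => ‖x‖) ρ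

/-- `ρ` is centered: its barycenter is `0`. -/
def Centered {d : ℕ} (ρ : Measure (Ed d)) : Prop := (∫ x, x ∂ρ) = 0

/-- Weak convergence of measures: convergence of integrals of bounded continuous functions. -/
def WeakConv {d : ℕ} (ρs : ℕ → Measure (Ed d)) (ρ : Measure (Ed d)) : Prop :=
  ∀ f : BoundedContinuousFunction (Ed d) ℝ,
    Tendsto (fun n => ∫ x, f x ∂(ρs n)) atTop (𝓝 (∫ x, f x ∂ρ))

/-- Convexity for extended-real-valued functions on `Ed d`. -/
def EConvexOn {d : ℕ} (u : Ed d → EReal) : Prop :=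
  ∀ x y : Ed d, ∀ a b : ℝ, 0 ≤ a → 0 ≤ b → a + b = 1 →
    u (a • x + b • y) ≤ (a : EReal) * u x + (b : EReal) * u y

/-- `e^{-t}` for `t ∈ ℝ ∪ {+∞}`, with `e^{-∞} = 0`. -/
def expNegE (t : EReal) : ℝ := if t = ⊤ then 0 else Real.exp (-t.toReal)

/-- The Legendre transform `u*(y) = sup_x (⟨x,y⟩ - u(x))`. -/
def legendre {d : ℕ} (u : Ed d → EReal) (y : Ed d) : EReal :=
  ⨆ x : Ed d, (((⟪x, y⟫ : ℝ) : EReal) - u x)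

/-- The essential continuity of a convex l.s.c. function `u : ℝ^d → ℝ ∪ {+∞}`:
`u` tends to `+∞` at `H^{d-1}`-a.e. point of the boundary of its domain. -/
def EssentiallyContinuous {d : ℕ} (u : Ed d → EReal) : Prop :=
  μH[(d : ℝ) - 1] {x : Ed d | x ∈ frontier {y | u y < ⊤} ∧ u x < ⊤} = 0

/-- Convexity for `[0, ∞]`-valued functions. -/
def ENNConvex {d : ℕ} (u : Ed d → ℝ≥0∞) : Prop :=
  ∀ x y : Ed d, ∀ a b : ℝ, 0 ≤ a → 0 ≤ b → a + b = 1 →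
    u (a • x + b • y) ≤ ENNReal.ofReal a * u x + ENNReal.ofReal b * u y

/-- The positive part of the Legendre transform of a nonnegative function. -/
def posConj {d : ℕ} (h : Ed d → ℝ≥0∞) (x : Ed d) : ℝ≥0∞ :=
  ⨆ y : Ed d, (ENNReal.ofReal ⟪x, y⟫ - h y)

/-- `e^{-t}` for `t ∈ [0, ∞]`. -/
def expNeg (t : ℝ≥0∞) : ℝ≥0∞ := EReal.exp (-(t : EReal))

section Basic

variable {d : ℕ}

lemma posConj_le_iff {h : Ed d → ℝ≥0∞} {x : Ed d} {c : ℝ≥0∞} :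
    posConj h x ≤ c ↔ ∀ y, ENNReal.ofReal ⟪x, y⟫ ≤ c + h y := by
  simp [posConj, iSup_le_iff, tsub_le_iff_right]

lemma ofReal_inner_le_posConj_add (h : Ed d → ℝ≥0∞) (x y : Ed d) :
    ENNReal.ofReal ⟪x, y⟫ ≤ posConj h x + h y :=
  posConj_le_iff.1 le_rfl y

lemma posConj_zero (h : Ed d → ℝ≥0∞) : posConj h 0 = 0 := by
  simp [posConj]

lemma ennConvex_posConj (h : Ed d → ℝ≥0∞) : ENNConvex (posConj h) := by
  intro x y a b ha hb hab
  rw [posConj_le_iff]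
  intro z
  have hx := ofReal_inner_le_posConj_add h x z
  have hy := ofReal_inner_le_posConj_add h y z
  calc ENNReal.ofReal ⟪a • x + b • y, z⟫
      ≤ ENNReal.ofReal a * ENNReal.ofReal ⟪x, z⟫ + ENNReal.ofReal b * ENNReal.ofReal ⟪y, z⟫ := by
        rw [← ENNReal.ofReal_mul ha, ← ENNReal.ofReal_mul hb, inner_add_left,
          real_inner_smul_left, real_inner_smul_left]
        exact ENNReal.ofReal_add_le
    _ ≤ ENNReal.ofReal a * (posConj h x + h z) + ENNReal.ofReal b * (posConj h y + h z) := by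
        gcongr
    _ = ENNReal.ofReal a * posConj h x + ENNReal.ofReal b * posConj h y +
          (ENNReal.ofReal a + ENNReal.ofReal b) * h z := by ring
    _ = _ := by rw [← ENNReal.ofReal_add ha hb, hab]; simp

lemma lowerSemicontinuous_posConj (h : Ed d → ℝ≥0∞) : LowerSemicontinuous (posConj h) := by
  apply lowerSemicontinuous_iSup
  intro y
  apply Continuous.lowerSemicontinuous
  have h1 : Continuous fun x : Ed d => ENNReal.ofReal ⟪x, y⟫ :=
    ENNReal.continuous_ofReal.comp (by fun_prop)
  exact ENNReal.continuous_sub_right _ |>.comp h1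

lemma measurable_posConj (h : Ed d → ℝ≥0∞) : Measurable (posConj h) :=
  (lowerSemicontinuous_posConj h).measurable

lemma ENNConvex.smul_le {u : Ed d → ℝ≥0∞} (hu : ENNConvex u) (h0 : u 0 = 0) (x : Ed d)
    {s : ℝ} (hs : 0 ≤ s) (hs1 : s ≤ 1) : u (s • x) ≤ ENNReal.ofReal s * u x := by
  have := hu x 0 s (1 - s) hs (by linarith) (by ring)
  simpa [h0] using this

lemma ENNConvex.convex_lt_top {u : Ed d → ℝ≥0∞} (hu : ENNConvex u) :
    Convex ℝ {x | u x < ⊤} := by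
  intro x hx y hy a b ha hb hab
  refine (hu x y a b ha hb hab).trans_lt ?_
  exact ENNReal.add_lt_top.2 ⟨ENNReal.mul_lt_top ENNReal.ofReal_lt_top hx,
    ENNReal.mul_lt_top ENNReal.ofReal_lt_top hy⟩

lemma ENNConvex.convexOn_toReal {u : Ed d → ℝ≥0∞} (hu : ENNConvex u) :
    ConvexOn ℝ {x | u x < ⊤} fun x => (u x).toReal := by
  refine ⟨hu.convex_lt_top, ?_⟩
  intro x hx y hy a b ha hb hab
  have hx' : u x ≠ ⊤ := ne_of_lt hx
  have hy' : u y ≠ ⊤ := ne_of_lt hy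
  have h1 : ENNReal.ofReal a * u x ≠ ⊤ := ENNReal.mul_ne_top ENNReal.ofReal_ne_top hx'
  have h2 : ENNReal.ofReal b * u y ≠ ⊤ := ENNReal.mul_ne_top ENNReal.ofReal_ne_top hy'
  have := ENNReal.toReal_mono (ENNReal.add_ne_top.2 ⟨h1, h2⟩) (hu x y a b ha hb hab)
  rw [ENNReal.toReal_add h1 h2, ENNReal.toReal_mul, ENNReal.toReal_mul,
    ENNReal.toReal_ofReal ha, ENNReal.toReal_ofReal hb] at this
  simpa using this

lemma expNeg_antitone : Antitone expNeg := by
  intro a b hab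
  apply EReal.exp_monotone
  rw [EReal.neg_le_neg_iff]
  exact_mod_cast hab

@[simp] lemma expNeg_top : expNeg ⊤ = 0 := by simp [expNeg]

@[simp] lemma expNeg_zero : expNeg 0 = 1 := by simp [expNeg]

lemma expNeg_le_one (t : ℝ≥0∞) : expNeg t ≤ 1 := by
  rw [← expNeg_zero]; exact expNeg_antitone bot_le

lemma expNeg_ne_top (t : ℝ≥0∞) : expNeg t ≠ ⊤ := ((expNeg_le_one t).trans_lt ENNReal.one_lt_top).ne

lemma expNeg_eq_zero_iff {t : ℝ≥0∞} : expNeg t = 0 ↔ t = ⊤ := by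
  simp [expNeg]

lemma expNeg_of_ne_top {t : ℝ≥0∞} (ht : t ≠ ⊤) :
    expNeg t = ENNReal.ofReal (Real.exp (-t.toReal)) := by
  lift t to NNReal using ht
  rw [expNeg, ← EReal.exp_coe]
  rfl

lemma expNeg_ofReal {r : ℝ} (hr : 0 ≤ r) :
    expNeg (ENNReal.ofReal r) = ENNReal.ofReal (Real.exp (-r)) := by
  rw [expNeg_of_ne_top ENNReal.ofReal_ne_top, ENNReal.toReal_ofReal hr]

lemma continuous_expNeg : Continuous expNeg := by
  exact ENNReal.continuous_exp.comp (continuous_neg.comp continuous_coe_ennreal_ereal)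

lemma measurable_expNeg : Measurable expNeg := continuous_expNeg.measurable

lemma expNeg_add (s t : ℝ≥0∞) : expNeg (s + t) = expNeg s * expNeg t := by
  by_cases hs : s = ⊤
  · simp [hs]
  by_cases ht : t = ⊤
  · simp [ht]
  rw [expNeg_of_ne_top hs, expNeg_of_ne_top ht, expNeg_of_ne_top (ENNReal.add_ne_top.2 ⟨hs, ht⟩),
    ENNReal.toReal_add hs ht, ← ENNReal.ofReal_mul (Real.exp_nonneg _), ← Real.exp_add]
  congr 2; ring

lemma expNeg_le_of_coercive {u : Ed d → ℝ≥0∞} {c M : ℝ}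
    (hu : ∀ x, ENNReal.ofReal (c * ‖x‖ - M) ≤ u x) :
    ∀ x, expNeg (u x) ≤ ENNReal.ofReal (Real.exp M * Real.exp (-(c * ‖x‖))) := by
  intro x
  refine (expNeg_antitone (hu x)).trans ?_
  rcases le_total 0 (c * ‖x‖ - M) with h | h
  · rw [expNeg_ofReal h, ← Real.exp_add]
    apply le_of_eq; congr 2; ring
  · rw [ENNReal.ofReal_of_nonpos h, expNeg_zero, ← Real.exp_add, ← ENNReal.ofReal_one]
    apply ENNReal.ofReal_le_ofReal
    apply Real.one_le_exp; linarith

lemma exists_lintegral_exp_neg_mul_norm_le (d : ℕ) : ∃ J : ℝ≥0∞, J ≠ ⊤ ∧ ∀ c : ℝ, 0 < c →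
    ∫⁻ x : Ed d, ENNReal.ofReal (Real.exp (-(c * ‖x‖))) ≤
      ENNReal.ofReal (Real.exp c * (d + 1).factorial / c ^ (d + 1)) * J := by
  refine ⟨∫⁻ x : Ed d, ENNReal.ofReal ((1 + ‖x‖) ^ (-((d : ℝ) + 1))), ?_, ?_⟩
  · exact (finite_integral_one_add_norm (by simp)).ne
  · intro c hc
    rw [← lintegral_const_mul' _ _ ENNReal.ofReal_ne_top]
    apply lintegral_mono
    intro x
    simp only
    rw [← ENNReal.ofReal_mul (by positivity)]
    apply ENNReal.ofReal_le_ofReal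
    have h1 : (0 : ℝ) < 1 + ‖x‖ := by positivity
    have h := Real.pow_div_factorial_le_exp (x := c * (1 + ‖x‖)) (by positivity) (d + 1)
    have h2 : (1 + ‖x‖) ^ (-((d : ℝ) + 1)) = ((1 + ‖x‖) ^ (d + 1))⁻¹ := by
      rw [Real.rpow_neg h1.le]
      congr 1
      exact_mod_cast Real.rpow_natCast (1 + ‖x‖) (d + 1)
    have h3 : Real.exp (-(c * ‖x‖)) = Real.exp c / Real.exp (c * (1 + ‖x‖)) := by
      rw [← Real.exp_sub]; congr 1; ring
    rw [h2, h3, ← div_eq_mul_inv, div_div, ← mul_pow, mul_div_assoc, div_eq_mul_inv (Real.exp c)]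
    gcongr
    rw [inv_le_comm₀ (Real.exp_pos _) (by positivity), inv_div]
    exact h

end Basic

/-- The points at which a sequence of functions is bounded by a finite constant. -/
def boundedPoints {d : ℕ} (u : ℕ → Ed d → ℝ≥0∞) : Set (Ed d) :=
  {x | ∃ T : ℝ≥0∞, T ≠ ⊤ ∧ ∀ n, u n x ≤ T}

section Compactness

variable {d : ℕ}

lemma exists_natCast_expNeg_lt {L : ℝ≥0∞} (hL : 0 < L) : ∃ n : ℕ, expNeg n < L := by
  have h : Tendsto (fun n : ℕ => expNeg n) atTop (𝓝 0) := by
    rw [← expNeg_top]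
    exact (continuous_expNeg.tendsto ⊤).comp ENNReal.tendsto_nat_nhds_top
  exact (h.eventually_lt_const hL).exists

lemma convex_boundedPoints {u : ℕ → Ed d → ℝ≥0∞} (hu : ∀ n, ENNConvex (u n)) :
    Convex ℝ (boundedPoints u) := by
  rintro x ⟨S, hS, hxS⟩ y ⟨T, hT, hyT⟩ a b ha hb hab
  refine ⟨ENNReal.ofReal a * S + ENNReal.ofReal b * T, ?_, fun n => (hu n x y a b ha hb hab).trans ?_⟩
  · exact ENNReal.add_ne_top.2 ⟨ENNReal.mul_ne_top ENNReal.ofReal_ne_top hS,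
      ENNReal.mul_ne_top ENNReal.ofReal_ne_top hT⟩
  · gcongr
    · exact hxS n
    · exact hyT n

lemma boundedPoints_subset_comp (u : ℕ → Ed d → ℝ≥0∞) (φ : ℕ → ℕ) :
    boundedPoints u ⊆ boundedPoints fun n => u (φ n) :=
  fun _ ⟨T, hT, h⟩ => ⟨T, hT, fun n => h (φ n)⟩

lemma exists_subseq_mem_boundedPoints {u : ℕ → Ed d → ℝ≥0∞} (hm : ∀ n, Measurable (u n))
    {B : Ed d → ℝ≥0∞} (hB : ∫⁻ x, B x ≠ ⊤) (hdom : ∀ n x, expNeg (u n x) ≤ B x)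
    {δ : ℝ≥0∞} (hδ : 0 < δ) (hZ : ∀ n, δ ≤ ∫⁻ x, expNeg (u n x))
    {W : Submodule ℝ (Ed d)} (hW : W ≠ ⊤) :
    ∃ φ : ℕ → ℕ, StrictMono φ ∧ ∃ x ∉ W, x ∈ boundedPoints fun n => u (φ n) := by
  have h1 := limsup_lintegral_le (f := fun n x => expNeg (u n x)) (μ := volume) B
    (fun n => measurable_expNeg.comp (hm n))
    (fun n => Eventually.of_forall (hdom n)) hB
  have h2 : δ ≤ limsup (fun n => ∫⁻ x, expNeg (u n x)) atTop := by
    apply le_limsup_of_frequently_le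
    · exact Frequently.of_forall hZ
    · exact isBoundedUnder_of ⟨⊤, fun _ => le_top⟩
  have h3 : ∃ x ∉ W, 0 < limsup (fun n => expNeg (u n x)) atTop := by
    by_contra! hcon
    have : ∫⁻ x, limsup (fun n => expNeg (u n x)) atTop = 0 := by
      apply lintegral_eq_zero_of_ae_eq_zero
      have hn : (volume : Measure (Ed d)) W = 0 := Measure.addHaar_submodule _ W hW
      have : ∀ᵐ x : Ed d, x ∉ W := by
        rw [ae_iff]; simpa using hn
      filter_upwards [this] with x hx
      simpa using hcon x hx
    exact absurd (hδ.trans_le (h2.trans h1)) (by simp [this])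
  obtain ⟨x, hxW, hx⟩ := h3
  obtain ⟨T, hT⟩ := exists_natCast_expNeg_lt hx
  have hfr := frequently_lt_of_lt_limsup (by isBoundedDefault) hT
  obtain ⟨φ, hφ, hφT⟩ := extraction_of_frequently_atTop hfr
  refine ⟨φ, hφ, x, hxW, T, ENNReal.natCast_ne_top T, fun n => ?_⟩
  by_contra! hlt
  exact (hφT n).not_ge (expNeg_antitone hlt.le)

lemma exists_subseq_span_boundedPoints_eq_top {u : ℕ → Ed d → ℝ≥0∞} (hm : ∀ n, Measurable (u n))
    {B : Ed d → ℝ≥0∞} (hB : ∫⁻ x, B x ≠ ⊤) (hdom : ∀ n x, expNeg (u n x) ≤ B x)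
    {δ : ℝ≥0∞} (hδ : 0 < δ) (hZ : ∀ n, δ ≤ ∫⁻ x, expNeg (u n x)) :
    ∃ φ : ℕ → ℕ, StrictMono φ ∧
      Submodule.span ℝ (boundedPoints fun n => u (φ n)) = ⊤ := by
  have key : ∀ k : ℕ, ∀ φ : ℕ → ℕ, StrictMono φ →
      d ≤ Module.finrank ℝ (Submodule.span ℝ (boundedPoints fun n => u (φ n))) + k →
      ∃ φ : ℕ → ℕ, StrictMono φ ∧
        Submodule.span ℝ (boundedPoints fun n => u (φ n)) = ⊤ := by
    intro k
    induction k with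
    | zero =>
      intro φ hφ h
      refine ⟨φ, hφ, Submodule.eq_top_of_finrank_eq (le_antisymm (Submodule.finrank_le _) ?_)⟩
      simpa using h
    | succ k ih =>
      intro φ hφ h
      by_cases hW : Submodule.span ℝ (boundedPoints fun n => u (φ n)) = ⊤
      · exact ⟨φ, hφ, hW⟩
      obtain ⟨ψ, hψ, x, hxW, hx⟩ := exists_subseq_mem_boundedPoints (u := fun n => u (φ n))
        (fun n => hm _) hB (fun n x => hdom _ x) hδ (fun n => hZ _) hW
      refine ih (φ ∘ ψ) (hφ.comp hψ) ?_
      have hlt : Submodule.span ℝ (boundedPoints fun n => u (φ n)) <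
          Submodule.span ℝ (boundedPoints fun n => u ((φ ∘ ψ) n)) := by
        refine lt_of_le_of_ne
          (Submodule.span_mono (boundedPoints_subset_comp (fun n => u (φ n)) ψ)) ?_
        intro heq
        apply hxW
        rw [heq]
        exact Submodule.subset_span hx
      have := Submodule.finrank_lt_finrank_of_lt hlt
      omega
  exact key d id strictMono_id (by omega)

lemma interior_boundedPoints_nonempty {u : ℕ → Ed d → ℝ≥0∞} (hu : ∀ n, ENNConvex (u n))
    (h0 : ∀ n, u n 0 = 0) (hs : Submodule.span ℝ (boundedPoints u) = ⊤) :
    (interior (boundedPoints u)).Nonempty := by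
  rw [(convex_boundedPoints hu).interior_nonempty_iff_affineSpan_eq_top]
  have hmem : (0 : Ed d) ∈ boundedPoints u := ⟨0, by simp, fun n => by simp [h0]⟩
  apply SetLike.coe_injective
  rw [← Set.insert_eq_of_mem hmem, affineSpan_insert_zero, hs]
  simp

lemma ENNReal_limsup_add_le (f g : ℕ → ℝ≥0∞) :
    limsup (fun n => f n + g n) atTop ≤ limsup f atTop + limsup g atTop := by
  by_cases hf : limsup f atTop = ⊤
  · simp [hf]
  by_cases hg : limsup g atTop = ⊤
  · simp [hg]
  apply ENNReal.le_of_forall_pos_le_add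
  intro ε hε _
  have hε2 : (ε / 2 : ℝ≥0∞) ≠ 0 := by simpa using hε.ne'
  have h1 := eventually_lt_of_limsup_lt (ENNReal.lt_add_right hf hε2)
  have h2 := eventually_lt_of_limsup_lt (ENNReal.lt_add_right hg hε2)
  refine limsup_le_of_le (by isBoundedDefault) ?_
  filter_upwards [h1, h2] with n hn1 hn2
  calc f n + g n ≤ (limsup f atTop + ε / 2) + (limsup g atTop + ε / 2) := by gcongr
    _ = limsup f atTop + limsup g atTop + (ε / 2 + ε / 2) := by ring
    _ = _ := by rw [ENNReal.add_halves]

lemma ennConvex_limsup {u : ℕ → Ed d → ℝ≥0∞} (hu : ∀ n, ENNConvex (u n)) :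
    ENNConvex fun x => limsup (fun n => u n x) atTop := by
  intro x y a b ha hb hab
  calc limsup (fun n => u n (a • x + b • y)) atTop
      ≤ limsup (fun n => ENNReal.ofReal a * u n x + ENNReal.ofReal b * u n y) atTop :=
        limsup_le_limsup (Eventually.of_forall fun n => hu n x y a b ha hb hab)
    _ ≤ _ := ENNReal_limsup_add_le _ _
    _ = _ := by
      rw [ENNReal.limsup_const_mul_of_ne_top ENNReal.ofReal_ne_top,
        ENNReal.limsup_const_mul_of_ne_top ENNReal.ofReal_ne_top]

end Compactness

section Selection

variable {d : ℕ}

lemma ENNReal_liminf_add_le (f g : ℕ → ℝ≥0∞) :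
    liminf (fun n => f n + g n) atTop ≤ liminf f atTop + limsup g atTop := by
  by_cases hf : liminf f atTop = ⊤
  · simp [hf]
  by_cases hg : limsup g atTop = ⊤
  · simp [hg]
  apply ENNReal.le_of_forall_pos_le_add
  intro ε hε _
  have hε2 : (ε / 2 : ℝ≥0∞) ≠ 0 := by simpa using hε.ne'
  have h1 := frequently_lt_of_liminf_lt (by isBoundedDefault) (ENNReal.lt_add_right hf hε2)
  have h2 := eventually_lt_of_limsup_lt (ENNReal.lt_add_right hg hε2)
  refine liminf_le_of_frequently_le ?_ (by isBoundedDefault)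
  refine (h1.and_eventually h2).mono ?_
  rintro n ⟨hn1, hn2⟩
  calc f n + g n ≤ (liminf f atTop + ε / 2) + (limsup g atTop + ε / 2) := by gcongr
    _ = liminf f atTop + limsup g atTop + (ε / 2 + ε / 2) := by ring
    _ = _ := by rw [ENNReal.add_halves]

lemma limsup_le_of_tendsto_of_ennConvex {u : ℕ → Ed d → ℝ≥0∞} (hu : ∀ n, ENNConvex (u n))
    {x z : Ed d} {a b : ℝ} (ha : 0 ≤ a) (hb : 0 ≤ b) (hab : a + b = 1) {l : ℝ≥0∞}
    (hq : Tendsto (fun n => u n (a • x + b • z)) atTop (𝓝 l)) :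
    l ≤ ENNReal.ofReal a * liminf (fun n => u n x) atTop +
      ENNReal.ofReal b * limsup (fun n => u n z) atTop := by
  rw [← hq.liminf_eq]
  calc liminf (fun n => u n (a • x + b • z)) atTop
      ≤ liminf (fun n => ENNReal.ofReal a * u n x + ENNReal.ofReal b * u n z) atTop :=
        liminf_le_liminf (Eventually.of_forall fun n => hu n x z a b ha hb hab)
    _ ≤ _ := ENNReal_liminf_add_le _ _
    _ = _ := by
      rw [ENNReal.limsup_const_mul_of_ne_top ENNReal.ofReal_ne_top,
        ENNReal.liminf_const_mul_of_ne_top ENNReal.ofReal_ne_top]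

lemma ENNConvex.continuousAt {u : Ed d → ℝ≥0∞} (hu : ENNConvex u) {x : Ed d}
    (hx : x ∈ interior {x | u x < ⊤}) : ContinuousAt u x := by
  have h1 : ContinuousAt (fun x => (u x).toReal) x :=
    hu.convexOn_toReal.continuousOn_interior.continuousAt (isOpen_interior.mem_nhds hx)
  have h2 : ContinuousAt (fun x => ENNReal.ofReal (u x).toReal) x :=
    ENNReal.continuous_ofReal.continuousAt.comp h1
  refine h2.congr ?_
  filter_upwards [isOpen_interior.mem_nhds hx] with y hy
  exact ENNReal.ofReal_toReal (ne_of_lt (show y ∈ {x | u x < ⊤} from interior_subset hy))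

lemma tendsto_limsup_of_dense {u : ℕ → Ed d → ℝ≥0∞} (hu : ∀ n, ENNConvex (u n)) {Q : Set (Ed d)}
    (hQ : Dense Q)
    (hlim : ∀ q ∈ Q, Tendsto (fun n => u n q) atTop (𝓝 (limsup (fun n => u n q) atTop)))
    (hint : (interior {x | limsup (fun n => u n x) atTop < ⊤}).Nonempty) {x : Ed d}
    (hx : x ∉ frontier {x | limsup (fun n => u n x) atTop < ⊤}) :
    Tendsto (fun n => u n x) atTop (𝓝 (limsup (fun n => u n x) atTop)) := by
  set b : Ed d → ℝ≥0∞ := fun x => limsup (fun n => u n x) atTop with hb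
  have hbc : ENNConvex b := ennConvex_limsup hu
  suffices h : b x ≤ liminf (fun n => u n x) atTop from
    tendsto_of_le_liminf_of_limsup_le h le_rfl
  by_cases hxi : x ∈ interior {x | b x < ⊤}
  · have hxt : b x < ⊤ := show x ∈ {x | b x < ⊤} from interior_subset hxi
    have hcx := hbc.continuousAt hxi
    have hne : (𝓝[Q] x).NeBot := mem_closure_iff_nhdsWithin_neBot.1 (hQ x)
    have h1 : Tendsto b (𝓝[Q] x) (𝓝 (b x)) := hcx.tendsto.mono_left nhdsWithin_le_nhds
    have h2 : Tendsto (fun q => b ((2 : ℝ) • q - x)) (𝓝[Q] x) (𝓝 (b x)) := by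
      have : Tendsto (fun q : Ed d => (2 : ℝ) • q - x) (𝓝 x) (𝓝 x) := by
        have : ContinuousAt (fun q : Ed d => (2 : ℝ) • q - x) x := by fun_prop
        convert this.tendsto using 2
        rw [two_smul]; abel
      exact (hcx.tendsto.comp this).mono_left nhdsWithin_le_nhds
    have h3 : Tendsto (fun q => ENNReal.ofReal (1 / 2) * liminf (fun n => u n x) atTop +
        ENNReal.ofReal (1 / 2) * b ((2 : ℝ) • q - x)) (𝓝[Q] x)
        (𝓝 (ENNReal.ofReal (1 / 2) * liminf (fun n => u n x) atTop +
          ENNReal.ofReal (1 / 2) * b x)) :=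
      tendsto_const_nhds.add (ENNReal.Tendsto.const_mul h2 (Or.inr ENNReal.ofReal_ne_top))
    have h4 : b x ≤ ENNReal.ofReal (1 / 2) * liminf (fun n => u n x) atTop +
          ENNReal.ofReal (1 / 2) * b x := by
      refine le_of_tendsto_of_tendsto h1 h3 ?_
      filter_upwards [self_mem_nhdsWithin] with q hq
      refine limsup_le_of_tendsto_of_ennConvex hu (by norm_num) (by norm_num) (by norm_num) ?_
      convert hlim q hq using 3
      rw [smul_sub, smul_smul]; norm_num
    by_contra! hlt
    have hA : liminf (fun n => u n x) atTop ≠ ⊤ := (hlt.trans hxt).ne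
    have h5 : ENNReal.ofReal (1 / 2) * liminf (fun n => u n x) atTop +
          ENNReal.ofReal (1 / 2) * b x < ENNReal.ofReal (1 / 2) * b x +
          ENNReal.ofReal (1 / 2) * b x := by
      apply ENNReal.add_lt_add_right (ENNReal.mul_ne_top ENNReal.ofReal_ne_top hxt.ne)
      exact (ENNReal.mul_lt_mul_iff_right (by norm_num) ENNReal.ofReal_ne_top).2 hlt
    rw [← add_mul, ← ENNReal.ofReal_add (by norm_num) (by norm_num)] at h5
    norm_num at h5
    norm_num at h4
    exact absurd (h4.trans_lt h5) (lt_irrefl _)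
  · have hxc : x ∉ closure {x | b x < ⊤} := fun h => hx ⟨h, hxi⟩
    obtain ⟨z₀, hz₀⟩ := hint
    have ho : IsOpen (closure {x | b x < ⊤})ᶜ := isClosed_closure.isOpen_compl
    have hev : ∀ᶠ l : ℝ in 𝓝[>] 0, (1 - l) • x + l • z₀ ∈ (closure {x | b x < ⊤})ᶜ := by
      apply nhdsWithin_le_nhds
      have : ContinuousAt (fun l : ℝ => (1 - l) • x + l • z₀) 0 := by fun_prop
      apply this.preimage_mem_nhds
      apply ho.mem_nhds
      simpa using hxc
    have hev1 : ∀ᶠ l : ℝ in 𝓝[>] 0, l < 1 := nhdsWithin_le_nhds (eventually_lt_nhds one_pos)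
    obtain ⟨l, hl, hl1, hl0⟩ := (hev.and (hev1.and self_mem_nhdsWithin)).exists
    have hl0 : 0 < l := hl0
    have hopen : IsOpen ((closure {x | b x < ⊤})ᶜ ∩
        (fun q : Ed d => l⁻¹ • (q - (1 - l) • x)) ⁻¹' interior {x | b x < ⊤}) :=
      ho.inter (isOpen_interior.preimage (by fun_prop))
    obtain ⟨q, ⟨hq1, hq2⟩, hqQ⟩ := hQ.inter_open_nonempty _ hopen
      ⟨(1 - l) • x + l • z₀, hl, by simpa [smul_smul, inv_mul_cancel₀ hl0.ne'] using hz₀⟩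
    have hbq : b q = ⊤ := by
      by_contra hne
      exact hq1 (subset_closure (lt_top_iff_ne_top.2 hne))
    have hbz : b (l⁻¹ • (q - (1 - l) • x)) < ⊤ :=
      show l⁻¹ • (q - (1 - l) • x) ∈ {x | b x < ⊤} from interior_subset hq2
    have := limsup_le_of_tendsto_of_ennConvex hu (x := x) (z := l⁻¹ • (q - (1 - l) • x))
      (a := 1 - l) (b := l) (by linarith) hl0.le (by ring) (l := b q) (by
        convert hlim q hqQ using 3
        rw [smul_smul, mul_inv_cancel₀ hl0.ne']; simp)
    rw [hbq, top_le_iff, ENNReal.add_eq_top] at this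
    rcases this with h | h
    · have : liminf (fun n => u n x) atTop = ⊤ := by
        by_contra hne
        exact ENNReal.mul_ne_top ENNReal.ofReal_ne_top hne h
      rw [this]; exact le_top
    · exact absurd h (ENNReal.mul_ne_top ENNReal.ofReal_ne_top hbz.ne)

/-- A sequence of convex functions, dominated from below and with Gibbs masses bounded away from
zero, has an almost everywhere convergent subsequence. -/
theorem exists_subseq_tendsto_ae {u : ℕ → Ed d → ℝ≥0∞} (hu : ∀ n, ENNConvex (u n))
    (hm : ∀ n, Measurable (u n)) (h0 : ∀ n, u n 0 = 0)
    {B : Ed d → ℝ≥0∞} (hB : ∫⁻ x, B x ≠ ⊤) (hdom : ∀ n x, expNeg (u n x) ≤ B x)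
    {δ : ℝ≥0∞} (hδ : 0 < δ) (hZ : ∀ n, δ ≤ ∫⁻ x, expNeg (u n x)) :
    ∃ φ : ℕ → ℕ, StrictMono φ ∧ ∃ g : Ed d → ℝ≥0∞,
      ∀ᵐ x, Tendsto (fun n => u (φ n) x) atTop (𝓝 (g x)) := by
  obtain ⟨φ, hφ, hspan⟩ := exists_subseq_span_boundedPoints_eq_top hm hB hdom hδ hZ
  obtain ⟨l, ψ, hψ, hl⟩ := CompactSpace.tendsto_subseq
    (fun n : ℕ => fun k : ℕ => u (φ n) (TopologicalSpace.denseSeq (Ed d) k))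
  refine ⟨φ ∘ ψ, hφ.comp hψ, fun x => limsup (fun n => u ((φ ∘ ψ) n) x) atTop, ?_⟩
  have hint : (interior {x | limsup (fun n => u ((φ ∘ ψ) n) x) atTop < ⊤}).Nonempty := by
    refine (interior_boundedPoints_nonempty (fun n => hu (φ n)) (fun n => h0 _) hspan).mono ?_
    apply interior_mono
    rintro x ⟨T, hT, h⟩
    exact (limsup_le_of_le (by isBoundedDefault)
      (Eventually.of_forall fun n => h (ψ n))).trans_lt (lt_top_iff_ne_top.2 hT)
  have hconv := ennConvex_limsup (fun n => hu ((φ ∘ ψ) n))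
  have hnull := hconv.convex_lt_top.addHaar_frontier (volume : Measure (Ed d))
  have hae : ∀ᵐ x : Ed d, x ∉ frontier {x | limsup (fun n => u ((φ ∘ ψ) n) x) atTop < ⊤} := by
    rw [ae_iff]; simpa using hnull
  filter_upwards [hae] with x hx
  refine tendsto_limsup_of_dense (fun n => hu _) (TopologicalSpace.denseRange_denseSeq (Ed d))
    ?_ hint hx
  rintro _ ⟨k, rfl⟩
  have hk := (tendsto_pi_nhds.1 hl) k
  have hk' : Tendsto (fun n => u ((φ ∘ ψ) n) (TopologicalSpace.denseSeq (Ed d) k)) atTop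
    (𝓝 (l k)) := hk
  rw [hk'.limsup_eq]
  exact hk'

end Selection

/-- The total mass of the log-concave measure with potential `posConj h`. -/
def gibbsMass {d : ℕ} (h : Ed d → ℝ≥0∞) : ℝ≥0∞ := ∫⁻ x, expNeg (posConj h x)

/-- The functional whose maximizers solve the moment measure problem. -/
def momentFunctional {d : ℕ} (μ : Measure (Ed d)) (h : Ed d → ℝ≥0∞) : ℝ≥0∞ :=
  gibbsMass h * expNeg (∫⁻ y, h y ∂μ)

section Maximizer

variable {d : ℕ} {μ : Measure (Ed d)}

lemma integral_pos_part_inner_pos [IsProbabilityMeasure μ] (hμ1 : FirstMoment μ)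
    (hμc : Centered μ)
    (hμH : ¬ ∃ e : Ed d, ∃ ℓ : ℝ, ‖e‖ = 1 ∧ μ {y | (⟪y, e⟫ : ℝ) = ℓ} = 1)
    {e : Ed d} (he : ‖e‖ = 1) : 0 < ∫ y, max ⟪e, y⟫ 0 ∂μ := by
  have hid : Integrable (fun y : Ed d => y) μ := by
    have h : Integrable (fun y : Ed d => ‖y‖) μ := hμ1
    exact (integrable_norm_iff aestronglyMeasurable_id).1 h
  have hin : Integrable (fun y : Ed d => ⟪e, y⟫) μ := hid.const_inner e
  have h0 : ∫ y, ⟪e, y⟫ ∂μ = 0 := by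
    rw [integral_inner hid, show ∫ y, y ∂μ = 0 from hμc, inner_zero_right]
  have hpos : Integrable (fun y : Ed d => max ⟪e, y⟫ 0) μ := hin.pos_part
  refine lt_of_le_of_ne (integral_nonneg fun y => le_max_right _ _) fun hzero => ?_
  have h1 : (fun y : Ed d => max ⟪e, y⟫ 0) =ᵐ[μ] 0 :=
    (integral_eq_zero_iff_of_nonneg (fun y => le_max_right _ _) hpos).1 hzero.symm
  have h2 : (fun y : Ed d => max (-⟪e, y⟫) 0) =ᵐ[μ] 0 := by
    refine (integral_eq_zero_iff_of_nonneg (fun y => le_max_right _ _) hin.neg_part).1 ?_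
    have : ∀ y : Ed d, max (-⟪e, y⟫) 0 = max ⟪e, y⟫ 0 - ⟪e, y⟫ := by
      intro y
      rcases le_total 0 (⟪e, y⟫ : ℝ) with h | h
      · rw [max_eq_right (by linarith), max_eq_left h]; ring
      · rw [max_eq_left (by linarith), max_eq_right h]; ring
    refine (integral_congr_ae (Eventually.of_forall this)).trans ?_
    rw [integral_sub hpos hin, h0, ← hzero, sub_zero]
  apply hμH
  refine ⟨e, 0, he, ?_⟩
  rw [← mem_ae_iff_prob_eq_one (measurableSet_eq_fun (by fun_prop) measurable_const)]
  filter_upwards [h1, h2] with y hy1 hy2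
  simp only [Pi.zero_apply, max_eq_right_iff] at hy1 hy2
  rw [real_inner_comm]
  linarith

lemma exists_coercivity_const [IsProbabilityMeasure μ] (hμ1 : FirstMoment μ)
    (hμc : Centered μ)
    (hμH : ¬ ∃ e : Ed d, ∃ ℓ : ℝ, ‖e‖ = 1 ∧ μ {y | (⟪y, e⟫ : ℝ) = ℓ} = 1) :
    ∃ c : ℝ, 0 < c ∧ ∀ x : Ed d, ENNReal.ofReal (c * ‖x‖) ≤ ∫⁻ y, ENNReal.ofReal ⟪x, y⟫ ∂μ := by
  have hid : Integrable (fun y : Ed d => y) μ := by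
    have h : Integrable (fun y : Ed d => ‖y‖) μ := hμ1
    exact (integrable_norm_iff aestronglyMeasurable_id).1 h
  have hcont : ContinuousOn (fun e : Ed d => ∫ y, max ⟪e, y⟫ 0 ∂μ) (Metric.sphere 0 1) := by
    refine continuousOn_of_dominated (bound := fun y => ‖y‖) ?_ ?_ hμ1 ?_
    · intro e _
      exact (by fun_prop : Continuous fun y : Ed d => max (⟪e, y⟫ : ℝ) 0).aestronglyMeasurable
    · intro e he
      refine Eventually.of_forall fun y => ?_
      rw [mem_sphere_zero_iff_norm] at he
      have := abs_real_inner_le_norm e y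
      rw [he, one_mul] at this
      rw [Real.norm_of_nonneg (le_max_right _ _)]
      exact max_le ((le_abs_self _).trans this) (norm_nonneg _)
    · refine Eventually.of_forall fun y => ?_
      fun_prop
  obtain ⟨c, hc, hmin⟩ : ∃ c : ℝ, 0 < c ∧ ∀ e ∈ Metric.sphere (0 : Ed d) 1,
      c ≤ ∫ y, max ⟪e, y⟫ 0 ∂μ := by
    rcases (Metric.sphere (0 : Ed d) 1).eq_empty_or_nonempty with h | h
    · exact ⟨1, one_pos, fun e he => by simp [h] at he⟩
    · obtain ⟨e, he, hmin⟩ := (isCompact_sphere (0 : Ed d) 1).exists_isMinOn h hcont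
      exact ⟨_, integral_pos_part_inner_pos hμ1 hμc hμH (by simpa using he), fun e' he' => hmin he'⟩
  refine ⟨c, hc, fun x => ?_⟩
  by_cases hx : x = 0
  · simp [hx]
  have hx' : 0 < ‖x‖ := norm_pos_iff.2 hx
  have h1 := hmin (‖x‖⁻¹ • x) (by simp [norm_smul, hx'.ne'])
  have h2 : ∀ y, max (⟪‖x‖⁻¹ • x, y⟫ : ℝ) 0 = ‖x‖⁻¹ * max ⟪x, y⟫ 0 := by
    intro y
    rw [real_inner_smul_left, mul_max_of_nonneg _ _ (by positivity), mul_zero]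
  simp_rw [h2] at h1
  rw [integral_const_mul, le_inv_mul_iff₀ hx', mul_comm] at h1
  have h3 : Integrable (fun y : Ed d => max (⟪x, y⟫ : ℝ) 0) μ := (hid.const_inner x).pos_part
  calc ENNReal.ofReal (c * ‖x‖) ≤ ENNReal.ofReal (∫ y, max ⟪x, y⟫ 0 ∂μ) :=
        ENNReal.ofReal_le_ofReal h1
    _ = ∫⁻ y, ENNReal.ofReal (max ⟪x, y⟫ 0) ∂μ :=
        ofReal_integral_eq_lintegral_ofReal h3 (Eventually.of_forall fun y => le_max_right _ _)
    _ = _ := by simp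

lemma ofReal_sub_le_posConj [IsProbabilityMeasure μ] {c : ℝ}
    (hcμ : ∀ x : Ed d, ENNReal.ofReal (c * ‖x‖) ≤ ∫⁻ y, ENNReal.ofReal ⟪x, y⟫ ∂μ)
    {h : Ed d → ℝ≥0∞} (hF : ∫⁻ y, h y ∂μ ≠ ⊤) (x : Ed d) :
    ENNReal.ofReal (c * ‖x‖ - (∫⁻ y, h y ∂μ).toReal) ≤ posConj h x := by
  rw [ENNReal.ofReal_sub _ ENNReal.toReal_nonneg, ENNReal.ofReal_toReal hF, tsub_le_iff_right]
  calc _ ≤ ∫⁻ y, ENNReal.ofReal ⟪x, y⟫ ∂μ := hcμ x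
    _ ≤ ∫⁻ y, (posConj h x + h y) ∂μ := lintegral_mono fun y => ofReal_inner_le_posConj_add h x y
    _ = _ := by rw [lintegral_add_left measurable_const]; simp

lemma ofReal_mul_norm_sub_one_le_posConj [IsProbabilityMeasure μ] {c : ℝ} (hc : 0 < c)
    (hcμ : ∀ x : Ed d, ENNReal.ofReal (c * ‖x‖) ≤ ∫⁻ y, ENNReal.ofReal ⟪x, y⟫ ∂μ)
    {h : Ed d → ℝ≥0∞} (hF : ∫⁻ y, h y ∂μ ≠ ⊤) (x : Ed d) :
    ENNReal.ofReal (c / ((∫⁻ y, h y ∂μ).toReal + 1) * ‖x‖ - 1) ≤ posConj h x := by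
  set F := (∫⁻ y, h y ∂μ).toReal with hFdef
  have hF0 : 0 ≤ F := ENNReal.toReal_nonneg
  rcases le_or_gt (c * ‖x‖) (F + 1) with hle | hlt
  · rw [ENNReal.ofReal_of_nonpos]
    · exact bot_le
    · rw [div_mul_eq_mul_div, sub_nonpos, div_le_one (by linarith)]; exact hle
  · have hcx : 0 < c * ‖x‖ := by linarith
    have h1 := ofReal_sub_le_posConj hcμ hF (((F + 1) / (c * ‖x‖)) • x)
    have h2 := (ennConvex_posConj h).smul_le (posConj_zero h) x
      (s := (F + 1) / (c * ‖x‖)) (by positivity) (by rw [div_le_one hcx]; exact hlt.le)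
    have h3 : c * ‖((F + 1) / (c * ‖x‖)) • x‖ - F = 1 := by
      rw [norm_smul, Real.norm_of_nonneg (by positivity)]
      have : ‖x‖ ≠ 0 := by rintro h; simp [h] at hcx
      field_simp
      ring
    rw [← hFdef, h3, ENNReal.ofReal_one] at h1
    have h4 := h1.trans h2
    calc ENNReal.ofReal (c / (F + 1) * ‖x‖ - 1) ≤ ENNReal.ofReal (c / (F + 1) * ‖x‖) :=
          ENNReal.ofReal_le_ofReal (by linarith)
      _ = ENNReal.ofReal (c / (F + 1) * ‖x‖) * 1 := by rw [mul_one]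
      _ ≤ ENNReal.ofReal (c / (F + 1) * ‖x‖) *
            (ENNReal.ofReal ((F + 1) / (c * ‖x‖)) * posConj h x) := by gcongr
      _ = posConj h x := by
        rw [← mul_assoc, ← ENNReal.ofReal_mul (by positivity)]
        have : c / (F + 1) * ‖x‖ * ((F + 1) / (c * ‖x‖)) = 1 := by
          have h5 : F + 1 ≠ 0 := by linarith
          have : ‖x‖ ≠ 0 := by rintro h; simp [h] at hcx
          field_simp
        rw [this]; simp

lemma exists_momentFunctional_le [IsProbabilityMeasure μ] {c : ℝ} (hc : 0 < c)
    (hcμ : ∀ x : Ed d, ENNReal.ofReal (c * ‖x‖) ≤ ∫⁻ y, ENNReal.ofReal ⟪x, y⟫ ∂μ) :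
    ∃ C : ℝ≥0∞, C ≠ ⊤ ∧ ∀ h : Ed d → ℝ≥0∞,
      momentFunctional μ h ≤ C * expNeg ((∫⁻ y, h y ∂μ) / 2) := by
  obtain ⟨J, hJ, hJle⟩ := exists_lintegral_exp_neg_mul_norm_le d
  refine ⟨ENNReal.ofReal (Real.exp 1 * (Real.exp c * (d + 1).factorial / c ^ (d + 1)) *
    (2 ^ (d + 1) * (d + 1).factorial * Real.exp (1 / 2))) * J,
    ENNReal.mul_ne_top ENNReal.ofReal_ne_top hJ, fun h => ?_⟩
  by_cases hF : ∫⁻ y, h y ∂μ = ⊤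
  · simp [momentFunctional, hF]
  set F := (∫⁻ y, h y ∂μ).toReal with hFdef
  have hF0 : 0 ≤ F := ENNReal.toReal_nonneg
  have hk : 0 < c / (F + 1) := by positivity
  have h1 : gibbsMass h ≤ ENNReal.ofReal (Real.exp 1) *
      (ENNReal.ofReal (Real.exp (c / (F + 1)) * (d + 1).factorial / (c / (F + 1)) ^ (d + 1)) * J) := by
    calc gibbsMass h ≤ ∫⁻ x : Ed d,
          ENNReal.ofReal (Real.exp 1 * Real.exp (-(c / (F + 1) * ‖x‖))) :=
          lintegral_mono (expNeg_le_of_coercive (ofReal_mul_norm_sub_one_le_posConj hc hcμ hF))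
      _ = ENNReal.ofReal (Real.exp 1) *
            ∫⁻ x : Ed d, ENNReal.ofReal (Real.exp (-(c / (F + 1) * ‖x‖))) := by
          rw [← lintegral_const_mul' _ _ ENNReal.ofReal_ne_top]
          simp_rw [ENNReal.ofReal_mul (Real.exp_nonneg 1)]
      _ ≤ _ := by gcongr; exact hJle _ hk
  have h2 : expNeg (∫⁻ y, h y ∂μ) = ENNReal.ofReal (Real.exp (-F)) := expNeg_of_ne_top hF
  have h3 : expNeg ((∫⁻ y, h y ∂μ) / 2) = ENNReal.ofReal (Real.exp (-(F / 2))) := by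
    rw [expNeg_of_ne_top (ENNReal.div_ne_top hF (by norm_num)), ENNReal.toReal_div]
    simp [hFdef]
  rw [momentFunctional, h2, h3]
  calc _ ≤ ENNReal.ofReal (Real.exp 1) *
      (ENNReal.ofReal (Real.exp (c / (F + 1)) * (d + 1).factorial / (c / (F + 1)) ^ (d + 1)) * J) *
      ENNReal.ofReal (Real.exp (-F)) := by gcongr
    _ = ENNReal.ofReal (Real.exp 1 *
      (Real.exp (c / (F + 1)) * (d + 1).factorial / (c / (F + 1)) ^ (d + 1)) *
      Real.exp (-F)) * J := by
        rw [ENNReal.ofReal_mul (by positivity), ENNReal.ofReal_mul (by positivity)]; ring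
    _ ≤ ENNReal.ofReal (Real.exp 1 * (Real.exp c * (d + 1).factorial / c ^ (d + 1)) *
      (2 ^ (d + 1) * (d + 1).factorial * Real.exp (1 / 2)) * Real.exp (-(F / 2))) * J := by
        gcongr ENNReal.ofReal ?_ * J
        have h4 := Real.pow_div_factorial_le_exp (x := (F + 1) / 2) (by positivity) (d + 1)
        rw [div_le_iff₀ (by positivity), div_pow, div_le_iff₀ (by positivity)] at h4
        have h5 : Real.exp ((F + 1) / 2) * Real.exp (-F) = Real.exp (1 / 2) * Real.exp (-(F / 2)) := by
          rw [← Real.exp_add, ← Real.exp_add]; congr 1; ring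
        have h6 : c / (F + 1) ≤ c := div_le_self hc.le (by linarith)
        calc Real.exp 1 * (Real.exp (c / (F + 1)) * (d + 1).factorial / (c / (F + 1)) ^ (d + 1)) *
              Real.exp (-F)
            = Real.exp 1 * (Real.exp (c / (F + 1)) * (d + 1).factorial / c ^ (d + 1)) *
              ((F + 1) ^ (d + 1) * Real.exp (-F)) := by
              rw [div_pow]; field_simp
          _ ≤ Real.exp 1 * (Real.exp c * (d + 1).factorial / c ^ (d + 1)) *
              (Real.exp ((F + 1) / 2) * (d + 1).factorial * 2 ^ (d + 1) * Real.exp (-F)) := by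
              gcongr
          _ = Real.exp 1 * (Real.exp c * (d + 1).factorial / c ^ (d + 1)) *
              ((d + 1).factorial * 2 ^ (d + 1) * (Real.exp ((F + 1) / 2) * Real.exp (-F))) := by ring
          _ = _ := by rw [h5]; ring
    _ = _ := by rw [ENNReal.ofReal_mul (by positivity)]; ring

end Maximizer

section Existence

variable {d : ℕ} {μ : Measure (Ed d)}

lemma momentFunctional_norm_pos [IsProbabilityMeasure μ] (hμ1 : FirstMoment μ) :
    0 < momentFunctional μ fun y => ENNReal.ofReal ‖y‖ := by
  have h1 : ∀ x ∈ Metric.ball (0 : Ed d) 1, posConj (fun y : Ed d => ENNReal.ofReal ‖y‖) x = 0 := by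
    intro x hx
    rw [mem_ball_zero_iff] at hx
    rw [← nonpos_iff_eq_zero, posConj_le_iff]
    intro y
    rw [zero_add]
    apply ENNReal.ofReal_le_ofReal
    calc ⟪x, y⟫ ≤ ‖x‖ * ‖y‖ := real_inner_le_norm x y
      _ ≤ 1 * ‖y‖ := by gcongr
      _ = ‖y‖ := one_mul _
  refine ENNReal.mul_pos ?_ ?_
  · apply ne_of_gt
    calc 0 < volume (Metric.ball (0 : Ed d) 1) := Metric.measure_ball_pos _ _ one_pos
      _ = ∫⁻ _ in Metric.ball (0 : Ed d) 1, 1 := by simp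
      _ = ∫⁻ x in Metric.ball (0 : Ed d) 1, expNeg (posConj (fun y => ENNReal.ofReal ‖y‖) x) := by
        apply setLIntegral_congr_fun Metric.isOpen_ball.measurableSet
        intro x hx
        simp only [h1 x hx, expNeg_zero]
      _ ≤ _ := setLIntegral_le_lintegral _ _
  · rw [Ne, expNeg_eq_zero_iff]
    have h : Integrable (fun y : Ed d => ‖y‖) μ := hμ1
    exact (h.lintegral_lt_top).ne

lemma posConj_liminf_le {h : ℕ → Ed d → ℝ≥0∞} {x : Ed d} {l : ℝ≥0∞}
    (hl : Tendsto (fun n => posConj (h n) x) atTop (𝓝 l)) :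
    posConj (fun y => liminf (fun n => h n y) atTop) x ≤ l := by
  rw [posConj_le_iff]
  intro y
  rw [← hl.limsup_eq, add_comm]
  refine le_trans ?_ (ENNReal_liminf_add_le _ _)
  refine le_liminf_of_le (by isBoundedDefault) (Eventually.of_forall fun n => ?_)
  rw [add_comm]
  exact ofReal_inner_le_posConj_add (h n) x y

/-- The functional attains its supremum along a suitable sequence. -/
lemma exists_le_momentFunctional [IsProbabilityMeasure μ] {c : ℝ} (hc : 0 < c)
    (hcμ : ∀ x : Ed d, ENNReal.ofReal (c * ‖x‖) ≤ ∫⁻ y, ENNReal.ofReal ⟪x, y⟫ ∂μ)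
    {h : ℕ → Ed d → ℝ≥0∞} (hm : ∀ n, Measurable (h n)) {S : ℝ≥0∞} (hS : 0 < S) (hS' : S ≠ ⊤)
    (hlim : Tendsto (fun n => momentFunctional μ (h n)) atTop (𝓝 S)) :
    ∃ f : Ed d → ℝ≥0∞, Measurable f ∧ S ≤ momentFunctional μ f := by
  obtain ⟨C, hC, hCle⟩ := exists_momentFunctional_le hc hcμ
  have hhalf : 0 < S / 2 := ENNReal.half_pos hS.ne'
  have hhalf' : S / 2 < S := ENNReal.half_lt_self hS.ne' hS'
  obtain ⟨N, hN⟩ : ∃ N : ℕ, C * expNeg N < S / 2 := by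
    have h : Tendsto (fun n : ℕ => C * expNeg n) atTop (𝓝 (C * 0)) := by
      refine ENNReal.Tendsto.const_mul ?_ (Or.inr hC)
      rw [← expNeg_top]
      exact (continuous_expNeg.tendsto ⊤).comp ENNReal.tendsto_nat_nhds_top
    rw [mul_zero] at h
    exact (h.eventually_lt_const hhalf).exists
  obtain ⟨n₀, hn₀⟩ := eventually_atTop.1 (hlim.eventually_const_lt hhalf')
  set k : ℕ → Ed d → ℝ≥0∞ := fun n => h (n₀ + n) with hk
  have hkS : ∀ n, S / 2 < momentFunctional μ (k n) := fun n => hn₀ _ (Nat.le_add_right _ _)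
  have hklim : Tendsto (fun n => momentFunctional μ (k n)) atTop (𝓝 S) := by
    refine hlim.comp ?_
    exact tendsto_atTop_mono (fun n => Nat.le_add_left n n₀) tendsto_id
  have hF : ∀ n, ∫⁻ y, k n y ∂μ ≤ 2 * N := by
    intro n
    by_contra! hlt
    have h1 : (N : ℝ≥0∞) ≤ (∫⁻ y, k n y ∂μ) / 2 := by
      rw [ENNReal.le_div_iff_mul_le (by simp) (by simp), mul_comm]
      exact hlt.le
    have h2 := (hkS n).trans_le ((hCle (k n)).trans (mul_le_mul_right (expNeg_antitone h1) C))
    exact lt_irrefl _ (h2.trans hN)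
  have hFt : ∀ n, ∫⁻ y, k n y ∂μ ≠ ⊤ := fun n =>
    ((hF n).trans_lt (ENNReal.mul_lt_top (by simp) (by simp))).ne
  have hZ : ∀ n, S / 2 ≤ ∫⁻ x, expNeg (posConj (k n) x) := by
    intro n
    calc S / 2 ≤ gibbsMass (k n) * expNeg (∫⁻ y, k n y ∂μ) := (hkS n).le
      _ ≤ gibbsMass (k n) * 1 := by gcongr; exact expNeg_le_one _
      _ = _ := mul_one _
  have hdom : ∀ n x, expNeg (posConj (k n) x) ≤
      ENNReal.ofReal (Real.exp (2 * N) * Real.exp (-(c * ‖x‖))) := by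
    intro n
    refine expNeg_le_of_coercive fun x => ?_
    refine le_trans (ENNReal.ofReal_le_ofReal ?_) (ofReal_sub_le_posConj hcμ (hFt n) x)
    have := ENNReal.toReal_mono (ENNReal.mul_ne_top (by simp) (by simp)) (hF n)
    simp only [ENNReal.toReal_mul, ENNReal.toReal_ofNat, ENNReal.toReal_natCast] at this
    linarith
  have hB : ∫⁻ x : Ed d, ENNReal.ofReal (Real.exp (2 * N) * Real.exp (-(c * ‖x‖))) ≠ ⊤ := by
    obtain ⟨J, hJ, hJle⟩ := exists_lintegral_exp_neg_mul_norm_le d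
    simp_rw [ENNReal.ofReal_mul (Real.exp_nonneg _)]
    rw [lintegral_const_mul' _ _ ENNReal.ofReal_ne_top]
    exact ENNReal.mul_ne_top ENNReal.ofReal_ne_top
      ((hJle c hc).trans_lt (ENNReal.mul_lt_top ENNReal.ofReal_lt_top hJ.lt_top)).ne
  obtain ⟨φ, hφ, g, hg⟩ := exists_subseq_tendsto_ae (fun n => ennConvex_posConj (k n))
    (fun n => measurable_posConj (k n)) (fun n => posConj_zero (k n)) hB hdom hhalf hZ
  obtain ⟨F, ψ, hψ, hFlim⟩ := CompactSpace.tendsto_subseq (fun n => ∫⁻ y, k (φ n) y ∂μ)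
  have hsub : Tendsto (fun n => φ (ψ n)) atTop atTop := (hφ.comp hψ).tendsto_atTop
  have hZlim : Tendsto (fun n => ∫⁻ x, expNeg (posConj (k (φ (ψ n))) x)) atTop
      (𝓝 (∫⁻ x, expNeg (g x))) := by
    refine tendsto_lintegral_of_dominated_convergence _
      (fun n => measurable_expNeg.comp (measurable_posConj _))
      (fun n => Eventually.of_forall (hdom _)) hB ?_
    filter_upwards [hg] with x hx
    exact (continuous_expNeg.tendsto _).comp (hx.comp hψ.tendsto_atTop)
  refine ⟨fun y => liminf (fun n => k (φ (ψ n)) y) atTop,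
    Measurable.liminf fun n => hm _, ?_⟩
  have hZg : ∫⁻ x, expNeg (g x) ≠ ⊤ := by
    refine ((lintegral_mono_ae ?_).trans_lt hB.lt_top).ne
    filter_upwards [hg] with x hx
    exact le_of_tendsto ((continuous_expNeg.tendsto _).comp hx)
      (Eventually.of_forall fun n => hdom _ x)
  have hprod : Tendsto (fun n => momentFunctional μ (k (φ (ψ n)))) atTop
      (𝓝 ((∫⁻ x, expNeg (g x)) * expNeg F)) :=
    ENNReal.Tendsto.mul hZlim (Or.inr (expNeg_ne_top _))
      ((continuous_expNeg.tendsto _).comp hFlim) (Or.inr hZg)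
  rw [tendsto_nhds_unique (hklim.comp hsub) hprod]
  refine mul_le_mul' ?_ (expNeg_antitone ?_)
  · apply lintegral_mono_ae
    filter_upwards [hg] with x hx
    exact expNeg_antitone (posConj_liminf_le (hx.comp hψ.tendsto_atTop))
  · refine (lintegral_liminf_le fun n => hm _).trans ?_
    exact hFlim.liminf_eq.le

theorem exists_isMaxOn_momentFunctional [IsProbabilityMeasure μ] (hμ1 : FirstMoment μ) {c : ℝ}
    (hc : 0 < c)
    (hcμ : ∀ x : Ed d, ENNReal.ofReal (c * ‖x‖) ≤ ∫⁻ y, ENNReal.ofReal ⟪x, y⟫ ∂μ) :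
    ∃ f : Ed d → ℝ≥0∞, Measurable f ∧ f 0 = 0 ∧ ∫⁻ y, f y ∂μ ≠ ⊤ ∧ gibbsMass f ≠ 0 ∧
      gibbsMass f ≠ ⊤ ∧
      ∀ h : Ed d → ℝ≥0∞, Measurable h → momentFunctional μ h ≤ momentFunctional μ f := by
  obtain ⟨C, hC, hCle⟩ := exists_momentFunctional_le hc hcμ
  set A : Set ℝ≥0∞ := {t | ∃ h : Ed d → ℝ≥0∞, Measurable h ∧ momentFunctional μ h = t} with hA
  have hmem : momentFunctional μ (fun y : Ed d => ENNReal.ofReal ‖y‖) ∈ A :=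
    ⟨_, by fun_prop, rfl⟩
  have hpos : 0 < sSup A := (momentFunctional_norm_pos hμ1).trans_le (le_sSup hmem)
  have hfin : sSup A ≠ ⊤ := by
    refine ((sSup_le ?_).trans_lt hC.lt_top).ne
    rintro _ ⟨h, _, rfl⟩
    calc _ ≤ C * expNeg ((∫⁻ y, h y ∂μ) / 2) := hCle h
      _ ≤ C * 1 := by gcongr; exact expNeg_le_one _
      _ = C := mul_one C
  obtain ⟨t, _, ht, htA⟩ := exists_seq_tendsto_sSup ⟨_, hmem⟩ (OrderTop.bddAbove A)
  choose h hm hh using htA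
  obtain ⟨f, hf, hSf⟩ := exists_le_momentFunctional hc hcμ hm hpos hfin
    (by simpa [hh] using ht)
  have hSf' : sSup A ≤ momentFunctional μ (Function.update f 0 0) := by
    refine hSf.trans (mul_le_mul' ?_ (expNeg_antitone ?_))
    · refine lintegral_mono fun x => expNeg_antitone ?_
      rw [posConj_le_iff]
      intro y
      by_cases hy : y = 0
      · simp [hy]
      · simpa [hy] using ofReal_inner_le_posConj_add f x y
    · refine lintegral_mono fun y => ?_
      by_cases hy : y = 0
      · simp [hy]
      · simp [hy]
  have hpos' := hpos.trans_le hSf'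
  have hne := hpos'.ne'
  rw [momentFunctional, mul_ne_zero_iff, Ne, Ne, expNeg_eq_zero_iff] at hne
  have hmu : Measurable (Function.update f 0 0) := by
    have : Function.update f 0 0 = Set.indicator {0}ᶜ f := by
      ext y
      by_cases hy : y = 0 <;> simp [hy]
    exact this ▸ hf.indicator (measurableSet_singleton 0).compl
  refine ⟨Function.update f 0 0, hmu, by simp, hne.2, hne.1, ?_, fun h hmh =>
    (le_sSup (show momentFunctional μ h ∈ A from ⟨h, hmh, rfl⟩)).trans hSf'⟩
  intro htop
  have h1 := hCle (Function.update f 0 0)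
  rw [momentFunctional, htop, ENNReal.top_mul (by simpa [expNeg_eq_zero_iff] using hne.2)] at h1
  exact ENNReal.mul_ne_top hC (expNeg_ne_top _) (top_le_iff.1 h1)

end Existence

/-- `e^{-g*}` for the (untruncated) Legendre transform `g*` of a nonnegative function. -/
def expConj {d : ℕ} (g : Ed d → ℝ≥0∞) (x : Ed d) : ℝ≥0∞ :=
  ⨅ y : Ed d, ENNReal.ofReal (Real.exp (-⟪x, y⟫)) / expNeg (g y)

section KeyInequality

variable {d : ℕ} {μ : Measure (Ed d)}

lemma le_expConj_iff {g : Ed d → ℝ≥0∞} {x : Ed d} {a : ℝ≥0∞} :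
    a ≤ expConj g x ↔ ∀ y, a * expNeg (g y) ≤ ENNReal.ofReal (Real.exp (-⟪x, y⟫)) := by
  rw [expConj, le_iInf_iff]
  refine forall_congr' fun y => ENNReal.le_div_iff_mul_le (Or.inr ?_) (Or.inl (expNeg_ne_top _))
  exact (ENNReal.ofReal_pos.2 (Real.exp_pos _)).ne'

lemma expNeg_strictAnti : StrictAnti expNeg := by
  intro a b hab
  apply EReal.exp_strictMono
  rw [EReal.neg_lt_neg_iff]
  exact_mod_cast hab

lemma expNeg_le_ofReal_exp_neg_iff {s : ℝ≥0∞} {r : ℝ} :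
    expNeg s ≤ ENNReal.ofReal (Real.exp (-r)) ↔ ENNReal.ofReal r ≤ s := by
  rcases le_total r 0 with hr | hr
  · simp only [ENNReal.ofReal_of_nonpos hr, zero_le, iff_true]
    refine (expNeg_le_one s).trans ?_
    rw [← ENNReal.ofReal_one]
    exact ENNReal.ofReal_le_ofReal (Real.one_le_exp (by linarith))
  · rw [← expNeg_ofReal hr, expNeg_strictAnti.le_iff_ge]

lemma exists_expNeg_eq {a : ℝ≥0∞} (ha : a ≤ 1) : ∃ b, expNeg b = a := by
  by_cases h0 : a = 0
  · exact ⟨⊤, by simp [h0]⟩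
  have hat : a ≠ ⊤ := (ha.trans_lt ENNReal.one_lt_top).ne
  have hpos : 0 < a.toReal := ENNReal.toReal_pos h0 hat
  have hle : a.toReal ≤ 1 := by simpa using ENNReal.toReal_mono ENNReal.one_ne_top ha
  refine ⟨ENNReal.ofReal (-Real.log a.toReal), ?_⟩
  rw [expNeg_ofReal (by linarith [Real.log_nonpos hpos.le hle]), neg_neg, Real.exp_log hpos,
    ENNReal.ofReal_toReal hat]

lemma expNeg_le_expConj_iff {g : Ed d → ℝ≥0∞} {x : Ed d} {b : ℝ≥0∞} :
    expNeg b ≤ expConj g x ↔ posConj g x ≤ b := by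
  rw [le_expConj_iff, posConj_le_iff]
  refine forall_congr' fun y => ?_
  rw [← expNeg_add, expNeg_le_ofReal_exp_neg_iff]

lemma expNeg_posConj_le_expConj (g : Ed d → ℝ≥0∞) (x : Ed d) :
    expNeg (posConj g x) ≤ expConj g x :=
  expNeg_le_expConj_iff.2 le_rfl

lemma expConj_eq_of_le_one {g : Ed d → ℝ≥0∞} {x : Ed d} (h : expConj g x ≤ 1) :
    expConj g x = expNeg (posConj g x) := by
  refine le_antisymm ?_ (expNeg_posConj_le_expConj g x)
  obtain ⟨b, hb⟩ := exists_expNeg_eq h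
  rw [← hb]
  exact expNeg_antitone (expNeg_le_expConj_iff.1 hb.le)

lemma expConj_eq_of_apply_zero {g : Ed d → ℝ≥0∞} (h : g 0 = 0) (x : Ed d) :
    expConj g x = expNeg (posConj g x) := by
  apply expConj_eq_of_le_one
  simpa [h] using le_expConj_iff.1 (le_refl (expConj g x)) 0

lemma upperSemicontinuous_expConj (g : Ed d → ℝ≥0∞) : UpperSemicontinuous (expConj g) := by
  apply upperSemicontinuous_iInf
  intro y
  by_cases hy : expNeg (g y) = 0
  · have : (fun x : Ed d => ENNReal.ofReal (Real.exp (-⟪x, y⟫)) / expNeg (g y)) = fun _ => ⊤ := by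
      ext x
      rw [hy, ENNReal.div_zero (ENNReal.ofReal_pos.2 (Real.exp_pos _)).ne']
    rw [this]
    exact upperSemicontinuous_const
  · apply Continuous.upperSemicontinuous
    have h1 : Continuous fun x : Ed d => ENNReal.ofReal (Real.exp (-⟪x, y⟫)) :=
      ENNReal.continuous_ofReal.comp (by fun_prop)
    exact (ENNReal.continuous_div_const _ hy).comp h1

lemma measurable_expConj (g : Ed d → ℝ≥0∞) : Measurable (expConj g) :=
  (upperSemicontinuous_expConj g).measurable

lemma expConj_le_one_of_lt [IsProbabilityMeasure μ] {c : ℝ}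
    (hcμ : ∀ x : Ed d, ENNReal.ofReal (c * ‖x‖) ≤ ∫⁻ y, ENNReal.ofReal ⟪x, y⟫ ∂μ)
    {g : Ed d → ℝ≥0∞} (hg : ∫⁻ y, g y ∂μ ≠ ⊤) {x : Ed d}
    (hx : (∫⁻ y, g y ∂μ).toReal < c * ‖x‖) : expConj g x ≤ 1 := by
  by_contra! h
  rw [← expNeg_zero] at h
  have h1 := (ofReal_sub_le_posConj hcμ hg x).trans (expNeg_le_expConj_iff.1 h.le)
  simp at h1
  linarith

lemma lintegral_expConj_mul_le_of_le_one {g : Ed d → ℝ≥0∞} (hg : ∀ x, expConj g x ≤ 1) :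
    (∫⁻ x, expConj g x) * expNeg (∫⁻ y, g y ∂μ) = momentFunctional μ g := by
  simp_rw [fun x => expConj_eq_of_le_one (hg x)]
  rfl

/-- Among untruncated transforms the maximizer of the moment functional is still optimal. -/
lemma lintegral_expConj_mul_le [IsProbabilityMeasure μ] (hμ1 : FirstMoment μ) (hμc : Centered μ)
    {c : ℝ} (hc : 0 < c)
    (hcμ : ∀ x : Ed d, ENNReal.ofReal (c * ‖x‖) ≤ ∫⁻ y, ENNReal.ofReal ⟪x, y⟫ ∂μ)
    {S : ℝ≥0∞} (hS : ∀ h : Ed d → ℝ≥0∞, Measurable h → momentFunctional μ h ≤ S)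
    {g : Ed d → ℝ≥0∞} (hg : Measurable g) :
    (∫⁻ x, expConj g x) * expNeg (∫⁻ y, g y ∂μ) ≤ S := by
  by_cases hG : ∫⁻ y, g y ∂μ = ⊤
  · simp [hG]
  set G := (∫⁻ y, g y ∂μ).toReal with hGdef
  by_cases hle : ∀ x, expConj g x ≤ 1
  · rw [lintegral_expConj_mul_le_of_le_one hle]
    exact hS g hg
  push Not at hle
  obtain ⟨x₁, hx₁⟩ := hle
  have hball : ∀ x, 1 < expConj g x → x ∈ Metric.closedBall (0 : Ed d) (G / c) := by
    intro x hx
    rw [mem_closedBall_zero_iff, le_div_iff₀ hc, mul_comm]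
    by_contra! h
    exact absurd (expConj_le_one_of_lt hcμ hG h) (not_le.2 hx)
  obtain ⟨x₀, -, hx₀⟩ := (upperSemicontinuous_expConj g).upperSemicontinuousOn _ |>.exists_isMaxOn
    ⟨x₁, hball x₁ hx₁⟩ (isCompact_closedBall (0 : Ed d) (G / c))
  have h_one : 1 < expConj g x₀ := hx₁.trans_le (hx₀ (hball x₁ hx₁))
  have hmax : ∀ x, expConj g x ≤ expConj g x₀ := by
    intro x
    rcases le_or_gt (expConj g x) 1 with h | h
    · exact h.trans h_one.le
    · exact hx₀ (hball x h)
  have hfin : ∀ᵐ y ∂μ, g y < ⊤ := ae_lt_top hg hG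
  have hne : expConj g x₀ ≠ ⊤ := by
    obtain ⟨y, hy⟩ := hfin.exists
    have h1 := le_expConj_iff.1 (le_refl (expConj g x₀)) y
    intro h
    rw [h, ENNReal.top_mul (by simpa [expNeg_eq_zero_iff] using hy.ne)] at h1
    exact ENNReal.ofReal_ne_top (top_le_iff.1 h1)
  set m := Real.log (expConj g x₀).toReal with hm
  have hpos : 0 < (expConj g x₀).toReal := ENNReal.toReal_pos (zero_lt_one.trans h_one).ne' hne
  have hexp : expConj g x₀ = ENNReal.ofReal (Real.exp m) := by
    rw [hm, Real.exp_log hpos, ENNReal.ofReal_toReal hne]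
  have hnonneg : ∀ y, g y ≠ ⊤ → 0 ≤ (g y).toReal - m - ⟪x₀, y⟫ := by
    intro y hy
    have h1 := le_expConj_iff.1 (le_refl (expConj g x₀)) y
    rw [hexp, expNeg_of_ne_top hy, ← ENNReal.ofReal_mul (Real.exp_nonneg _), ← Real.exp_add,
      ENNReal.ofReal_le_ofReal_iff (Real.exp_nonneg _), Real.exp_le_exp] at h1
    linarith
  let h : Ed d → ℝ≥0∞ := fun y =>
    if g y = ⊤ then ⊤ else ENNReal.ofReal ((g y).toReal - m - ⟪x₀, y⟫)
  have hh : Measurable h := by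
    refine Measurable.ite (hg (measurableSet_singleton _)) measurable_const ?_
    exact ENNReal.measurable_ofReal.comp ((hg.ennreal_toReal.sub_const _).sub (by fun_prop))
  have hconj : ∀ x, expConj h x = ENNReal.ofReal (Real.exp (-m)) * expConj g (x + x₀) := by
    intro x
    rw [expConj, expConj, ENNReal.mul_iInf_of_ne (ENNReal.ofReal_pos.2 (Real.exp_pos _)).ne'
      ENNReal.ofReal_ne_top]
    refine iInf_congr fun y => ?_
    rw [← mul_div_assoc, ← ENNReal.ofReal_mul (Real.exp_nonneg _), ← Real.exp_add]
    by_cases hy : g y = ⊤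
    · simp only [h, hy, if_true, expNeg_top]
      rw [ENNReal.div_zero, ENNReal.div_zero] <;>
        exact (ENNReal.ofReal_pos.2 (Real.exp_pos _)).ne'
    · simp only [h, hy, if_false]
      rw [expNeg_ofReal (hnonneg y hy), expNeg_of_ne_top hy, ← ENNReal.ofReal_div_of_pos
        (Real.exp_pos _), ← ENNReal.ofReal_div_of_pos (Real.exp_pos _), ← Real.exp_sub,
        ← Real.exp_sub, inner_add_left]
      congr 2
      ring
  have hconj1 : ∀ x, expConj h x ≤ 1 := by
    intro x
    rw [hconj]
    calc _ ≤ ENNReal.ofReal (Real.exp (-m)) * ENNReal.ofReal (Real.exp m) := by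
          rw [← hexp]; gcongr; exact hmax _
      _ = 1 := by rw [← ENNReal.ofReal_mul (Real.exp_nonneg _), ← Real.exp_add]; simp
  have hid : Integrable (fun y : Ed d => y) μ := by
    have h : Integrable (fun y : Ed d => ‖y‖) μ := hμ1
    exact (integrable_norm_iff (by fun_prop)).1 h
  have hgi : Integrable (fun y => (g y).toReal) μ :=
    integrable_toReal_of_lintegral_ne_top hg.aemeasurable hG
  have hgm : Integrable (fun y => (g y).toReal - m) μ := hgi.sub (integrable_const _)
  have hin : Integrable (fun y => (g y).toReal - m - ⟪x₀, y⟫) μ := hgm.sub (hid.const_inner x₀)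
  have hnonneg' : ∀ᵐ y ∂μ, 0 ≤ (g y).toReal - m - ⟪x₀, y⟫ := by
    filter_upwards [hfin] with y hy
    exact hnonneg y hy.ne
  have hintr : ∫ y, ((g y).toReal - m - ⟪x₀, y⟫) ∂μ = G - m := by
    rw [integral_sub hgm (hid.const_inner x₀), integral_sub hgi (integrable_const _),
      integral_inner hid x₀, show (∫ y, y ∂μ) = 0 from hμc, inner_zero_right,
      integral_toReal hg.aemeasurable hfin]
    simp [hGdef]
  have hGm : 0 ≤ G - m := hintr ▸ integral_nonneg_of_ae hnonneg'
  have hint : ∫⁻ y, h y ∂μ = ENNReal.ofReal (G - m) := by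
    rw [← hintr, ofReal_integral_eq_lintegral_ofReal hin hnonneg']
    apply lintegral_congr_ae
    filter_upwards [hfin] with y hy
    simp [h, hy.ne]
  calc (∫⁻ x, expConj g x) * expNeg (∫⁻ y, g y ∂μ)
      = (∫⁻ x, expConj h x) * expNeg (∫⁻ y, h y ∂μ) := by
        simp_rw [hconj]
        rw [lintegral_const_mul' _ _ ENNReal.ofReal_ne_top,
          lintegral_add_right_eq_self (fun x => expConj g x) x₀, hint, expNeg_ofReal hGm,
          expNeg_of_ne_top hG, mul_comm (ENNReal.ofReal (Real.exp (-m))), mul_assoc,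
          ← ENNReal.ofReal_mul (Real.exp_nonneg _), ← Real.exp_add]
        congr 3
        ring
    _ = momentFunctional μ h := lintegral_expConj_mul_le_of_le_one hconj1
    _ ≤ S := hS h hh

end KeyInequality

/-- Maximizers of the moment functional, normalized at the origin, with optimality also tested
against untruncated transforms. -/
structure IsMomentMaximizer {d : ℕ} (μ : Measure (Ed d)) (f : Ed d → ℝ≥0∞) : Prop where
  measurable : Measurable f
  apply_zero : f 0 = 0
  lintegral_ne_top : ∫⁻ y, f y ∂μ ≠ ⊤
  gibbsMass_ne_zero : gibbsMass f ≠ 0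
  gibbsMass_ne_top : gibbsMass f ≠ ⊤
  lintegral_expConj_mul_le : ∀ g : Ed d → ℝ≥0∞, Measurable g →
    (∫⁻ x, expConj g x) * expNeg (∫⁻ y, g y ∂μ) ≤ gibbsMass f * expNeg (∫⁻ y, f y ∂μ)

/-- The difference quotient of `e^{-f*}` in the direction `ψ`. -/
def gibbsQuotient {d : ℕ} (f ψ : Ed d → ℝ≥0∞) (t : ℝ) (x : Ed d) : ℝ≥0∞ :=
  ENNReal.ofReal t⁻¹ *
    (expConj (fun y => f y + ENNReal.ofReal t * ψ y) x - expNeg (posConj f x))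

section Variation

variable {d : ℕ} {μ : Measure (Ed d)} {f ψ : Ed d → ℝ≥0∞}

lemma exists_isMomentMaximizer [IsProbabilityMeasure μ] (hμ1 : FirstMoment μ) (hμc : Centered μ)
    (hμH : ¬ ∃ e : Ed d, ∃ ℓ : ℝ, ‖e‖ = 1 ∧ μ {y | (⟪y, e⟫ : ℝ) = ℓ} = 1) :
    ∃ f : Ed d → ℝ≥0∞, IsMomentMaximizer μ f := by
  obtain ⟨c, hc, hcμ⟩ := exists_coercivity_const hμ1 hμc hμH
  obtain ⟨f, hf, h0, hF, hZ, hZ', hmax⟩ := exists_isMaxOn_momentFunctional hμ1 hc hcμ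
  exact ⟨f, hf, h0, hF, hZ, hZ', fun g hg => lintegral_expConj_mul_le hμ1 hμc hc hcμ hmax hg⟩

lemma measurable_gibbsQuotient (f ψ : Ed d → ℝ≥0∞) (t : ℝ) : Measurable (gibbsQuotient f ψ t) :=
  ((measurable_expConj _).sub (measurable_expNeg.comp (measurable_posConj f))).const_mul _

lemma expConj_anti {g h : Ed d → ℝ≥0∞} (hgh : g ≤ h) (x : Ed d) : expConj g x ≤ expConj h x := by
  rw [le_expConj_iff]
  intro y
  refine le_trans ?_ (le_expConj_iff.1 (le_refl (expConj g x)) y)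
  gcongr
  exact expNeg_antitone (hgh y)

lemma lintegral_gibbsQuotient_le (hf : IsMomentMaximizer μ f) (hψ : Measurable ψ)
    (hψμ : ∫⁻ y, ψ y ∂μ ≠ ⊤) {t : ℝ} (ht : 0 < t) :
    ∫⁻ x, gibbsQuotient f ψ t x ≤ gibbsMass f *
      ENNReal.ofReal (t⁻¹ * (Real.exp (t * (∫⁻ y, ψ y ∂μ).toReal) - 1)) := by
  set m := (∫⁻ y, ψ y ∂μ).toReal with hm
  have hm0 : 0 ≤ m := ENNReal.toReal_nonneg
  have h1 := hf.lintegral_expConj_mul_le (fun y => f y + ENNReal.ofReal t * ψ y)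
    (hf.measurable.add (hψ.const_mul _))
  rw [lintegral_add_left hf.measurable, lintegral_const_mul _ hψ, expNeg_add,
    mul_comm (expNeg _), ← mul_assoc, ENNReal.mul_le_mul_iff_left
      (by simpa [expNeg_eq_zero_iff] using hf.lintegral_ne_top) (expNeg_ne_top _),
    ← ENNReal.ofReal_toReal hψμ, ← ENNReal.ofReal_mul ht.le, ← hm,
    expNeg_ofReal (by positivity)] at h1
  have h2 : ∫⁻ x, expConj (fun y => f y + ENNReal.ofReal t * ψ y) x ≤
      gibbsMass f * ENNReal.ofReal (Real.exp (t * m)) := by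
    calc _ = (∫⁻ x, expConj (fun y => f y + ENNReal.ofReal t * ψ y) x) *
          ENNReal.ofReal (Real.exp (-(t * m))) * ENNReal.ofReal (Real.exp (t * m)) := by
          rw [mul_assoc, ← ENNReal.ofReal_mul (Real.exp_nonneg _), ← Real.exp_add]
          simp
      _ ≤ _ := by gcongr
  simp only [gibbsQuotient]
  rw [lintegral_const_mul' _ _ ENNReal.ofReal_ne_top, lintegral_sub
    (show Measurable fun x => expNeg (posConj f x) from
      measurable_expNeg.comp (measurable_posConj f)) hf.gibbsMass_ne_top, ENNReal.ofReal_mul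
    (by positivity), mul_left_comm]
  · gcongr
    rw [ENNReal.ofReal_sub _ zero_le_one, ENNReal.mul_sub fun _ _ => hf.gibbsMass_ne_top]
    simp only [ENNReal.ofReal_one, mul_one]
    exact tsub_le_tsub_right h2 _
  · refine Eventually.of_forall fun x => ?_
    beta_reduce
    rw [← expConj_eq_of_apply_zero hf.apply_zero]
    exact expConj_anti (fun y => le_self_add) x

lemma limsup_lintegral_gibbsQuotient_le (hf : IsMomentMaximizer μ f) (hψ : Measurable ψ) :
    limsup (fun t => ∫⁻ x, gibbsQuotient f ψ t x) (𝓝[>] 0) ≤ gibbsMass f * ∫⁻ y, ψ y ∂μ := by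
  by_cases hψμ : ∫⁻ y, ψ y ∂μ = ⊤
  · rw [hψμ, ENNReal.mul_top hf.gibbsMass_ne_zero]
    exact le_top
  set m := (∫⁻ y, ψ y ∂μ).toReal with hm
  have hlim : Tendsto (fun t : ℝ => t⁻¹ * (Real.exp (t * m) - 1)) (𝓝[>] 0) (𝓝 m) := by
    have h1 : HasDerivAt (fun t : ℝ => Real.exp (t * m)) m 0 := by
      simpa using ((hasDerivAt_id (0 : ℝ)).mul_const m).exp
    simpa using h1.tendsto_slope_zero_right
  have hlim' : Tendsto (fun t : ℝ => gibbsMass f *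
      ENNReal.ofReal (t⁻¹ * (Real.exp (t * m) - 1))) (𝓝[>] 0) (𝓝 (gibbsMass f * ∫⁻ y, ψ y ∂μ)) := by
    rw [← ENNReal.ofReal_toReal hψμ]
    exact ENNReal.Tendsto.const_mul (ENNReal.tendsto_ofReal hlim) (Or.inr hf.gibbsMass_ne_top)
  rw [← hlim'.limsup_eq]
  refine limsup_le_limsup ?_
  filter_upwards [self_mem_nhdsWithin] with t ht
  exact lintegral_gibbsQuotient_le hf hψ hψμ ht

lemma ofReal_inner_sub_le {u : ℝ≥0∞} {s : ℝ} {r : ℝ≥0∞} (h : ENNReal.ofReal s ≤ u + r)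
    (hu : u ≠ ⊤) (hr : r ≠ ⊤) : s ≤ u.toReal + r.toReal := by
  rw [← ENNReal.toReal_add hu hr]
  exact (ENNReal.ofReal_le_iff_le_toReal (ENNReal.add_ne_top.2 ⟨hu, hr⟩)).1 h

/-- At a point of differentiability the transform of `f + t ψ` is at most
`f* - t a` for every `a < ψ(∇f*)`. -/
lemma eventually_le_expConj {x : Ed d} (hx : x ∈ interior {x | posConj f x < ⊤})
    {p : Ed d} (hp : HasGradientAt (fun x => (posConj f x).toReal) p x)
    (hψ : LowerSemicontinuousAt ψ p) {a : ℝ} (hap : ENNReal.ofReal a < ψ p) :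
    ∀ᶠ t in 𝓝[>] 0, expNeg (posConj f x) * ENNReal.ofReal (Real.exp (t * a)) ≤
      expConj (fun y => f y + ENNReal.ofReal t * ψ y) x := by
  have hxt : posConj f x ≠ ⊤ := (show x ∈ {x | posConj f x < ⊤} from interior_subset hx).ne
  obtain ⟨δ, hδ, hball⟩ := Metric.eventually_nhds_iff.1 (hψ _ hap)
  have hlin := (hasFDerivAt_iff_isLittleO_nhds_zero.1 hp.hasFDerivAt).def (half_pos hδ)
  have hint : ∀ᶠ h in 𝓝 (0 : Ed d), posConj f (x + h) < ⊤ := by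
    have h1 : Tendsto (fun h : Ed d => x + h) (𝓝 0) (𝓝 x) := by
      have h2 : Continuous fun h : Ed d => x + h := by fun_prop
      simpa using h2.tendsto 0
    exact h1.eventually (mem_interior_iff_mem_nhds.1 hx)
  obtain ⟨r, hr, hr'⟩ := Metric.eventually_nhds_iff.1 (hlin.and hint)
  have hsmall : ∀ᶠ t in 𝓝[>] (0 : ℝ), t * a ≤ r / 2 * (δ / 2) := by
    have h1 : Tendsto (fun t : ℝ => t * a) (𝓝[>] 0) (𝓝 0) := by
      have h2 : Continuous fun t : ℝ => t * a := by fun_prop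
      simpa using (h2.tendsto 0).mono_left nhdsWithin_le_nhds
    exact (h1.eventually (gt_mem_nhds (by positivity : 0 < r / 2 * (δ / 2)))).mono fun _ h => h.le
  filter_upwards [hsmall, self_mem_nhdsWithin] with t ht ht0
  have ht0 : 0 < t := ht0
  rw [le_expConj_iff]
  intro y
  by_cases hfy : f y = ⊤
  · simp [hfy]
  rw [expNeg_add, expNeg_of_ne_top hxt, expNeg_of_ne_top hfy]
  by_cases hy : dist y p < δ
  · have h1 := ofReal_inner_sub_le (ofReal_inner_le_posConj_add f x y) hxt hfy
    have h2 : expNeg (ENNReal.ofReal t * ψ y) ≤ ENNReal.ofReal (Real.exp (-(t * a))) := by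
      rw [expNeg_le_ofReal_exp_neg_iff, ENNReal.ofReal_mul ht0.le]
      gcongr
      exact (hball hy).le
    calc _ ≤ ENNReal.ofReal (Real.exp (-(posConj f x).toReal)) * ENNReal.ofReal (Real.exp (t * a)) *
          (ENNReal.ofReal (Real.exp (-(f y).toReal)) * ENNReal.ofReal (Real.exp (-(t * a)))) := by
          gcongr
      _ ≤ _ := by
        simp only [← ENNReal.ofReal_mul, Real.exp_nonneg, ← Real.exp_add]
        apply ENNReal.ofReal_le_ofReal
        rw [Real.exp_le_exp]
        linarith
  · push Not at hy
    have hyp : 0 < ‖y - p‖ := by rw [← dist_eq_norm]; exact hδ.trans_le hy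
    set h : Ed d := (r / 2 / ‖y - p‖) • (y - p) with hh
    have hnorm : ‖h‖ = r / 2 := by
      rw [hh, norm_smul, Real.norm_of_nonneg (by positivity)]
      field_simp
    obtain ⟨h3, h4⟩ := hr' (y := h) (by rw [dist_zero_right, hnorm]; linarith)
    have h5 := ofReal_inner_sub_le (ofReal_inner_le_posConj_add f (x + h) y) h4.ne hfy
    rw [hnorm, Real.norm_eq_abs] at h3
    have h6 := (abs_le.1 h3).2
    simp only [InnerProductSpace.toDual_apply_apply] at h6
    have h7 : ⟪h, y⟫ - ⟪p, h⟫ = r / 2 * ‖y - p‖ := by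
      rw [real_inner_comm h p, ← inner_sub_right, hh, real_inner_smul_left,
        real_inner_self_eq_norm_sq]
      field_simp
    rw [inner_add_left] at h5
    have h8 : r / 2 * δ ≤ r / 2 * ‖y - p‖ := by
      gcongr; rwa [← dist_eq_norm]
    calc _ ≤ ENNReal.ofReal (Real.exp (-(posConj f x).toReal)) * ENNReal.ofReal (Real.exp (t * a)) *
          (ENNReal.ofReal (Real.exp (-(f y).toReal)) * 1) := by
          gcongr
          exact expNeg_le_one _
      _ ≤ _ := by
        simp only [← ENNReal.ofReal_mul, Real.exp_nonneg, ← Real.exp_add, mul_one]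
        apply ENNReal.ofReal_le_ofReal
        rw [Real.exp_le_exp]
        nlinarith

lemma mul_expNeg_le_liminf_gibbsQuotient {x : Ed d} (hx : x ∈ interior {x | posConj f x < ⊤})
    {p : Ed d} (hp : HasGradientAt (fun x => (posConj f x).toReal) p x)
    (hψ : LowerSemicontinuousAt ψ p) :
    ψ p * expNeg (posConj f x) ≤ liminf (fun t => gibbsQuotient f ψ t x) (𝓝[>] 0) := by
  refine ENNReal.mul_le_of_forall_lt fun a ha b hb => ?_
  have hat : a ≠ ⊤ := ha.ne_top
  have h1 := eventually_le_expConj hx hp hψ (a := a.toReal)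
    (by rwa [ENNReal.ofReal_toReal hat])
  refine le_liminf_of_le (by isBoundedDefault) ?_
  filter_upwards [h1, self_mem_nhdsWithin] with t ht ht0
  have ht0 : 0 < t := ht0
  have h2 : expNeg (posConj f x) * ENNReal.ofReal (t * a.toReal) ≤
      expConj (fun y => f y + ENNReal.ofReal t * ψ y) x - expNeg (posConj f x) := by
    refine le_trans ?_ (tsub_le_tsub_right ht _)
    refine ENNReal.le_sub_of_add_le_right (expNeg_ne_top _) ?_
    calc _ = expNeg (posConj f x) * ENNReal.ofReal (t * a.toReal + 1) := by
          rw [ENNReal.ofReal_add (by positivity) zero_le_one, mul_add]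
          simp
      _ ≤ _ := by
        gcongr
        exact Real.add_one_le_exp _
  calc a * b ≤ a * expNeg (posConj f x) := by gcongr
    _ = ENNReal.ofReal t⁻¹ * (expNeg (posConj f x) * ENNReal.ofReal (t * a.toReal)) := by
      rw [mul_left_comm, ← ENNReal.ofReal_mul (by positivity), ← mul_assoc,
        inv_mul_cancel₀ ht0.ne', one_mul, ENNReal.ofReal_toReal hat, mul_comm]
    _ ≤ _ := by
      rw [gibbsQuotient]
      gcongr

end Variation

lemma ENNReal_add_liminf_le {ι : Type*} (f g : ι → ℝ≥0∞) (l : Filter ι) :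
    liminf f l + liminf g l ≤ liminf (fun i => f i + g i) l := by
  rw [liminf_eq_iSup_iInf, liminf_eq_iSup_iInf]
  refine ENNReal.biSup_add_biSup_le' ⟨_, univ_mem⟩ ⟨_, univ_mem⟩ fun s hs t ht => ?_
  refine le_liminf_of_le (by isBoundedDefault) ?_
  filter_upwards [hs, ht] with i hi hi'
  exact add_le_add (iInf₂_le i hi) (iInf₂_le i hi')

lemma measurable_gradient {d : ℕ} (g : Ed d → ℝ) : Measurable (gradient g) := by
  have h : gradient g = fun x => (InnerProductSpace.toDual ℝ (Ed d)).symm (fderiv ℝ g x) := rfl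
  rw [h]
  exact (LinearIsometryEquiv.continuous _).measurable.comp (measurable_fderiv ℝ g)

/-- A convex function is differentiable almost everywhere in its domain. -/
lemma ENNConvex.ae_hasGradientAt {d : ℕ} {u : Ed d → ℝ≥0∞} (hu : ENNConvex u) :
    ∀ᵐ x, u x < ⊤ → x ∈ interior {x | u x < ⊤} ∧
      HasGradientAt (fun x => (u x).toReal) (gradient (fun x => (u x).toReal) x) x := by
  have hfr : ∀ᵐ x, x ∉ frontier {x | u x < ⊤} :=
    measure_eq_zero_iff_ae_notMem.1 (hu.convex_lt_top.addHaar_frontier volume)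
  have hdiff : ∀ᵐ x, ¬ (x ∈ interior {x | u x < ⊤} ∧
      ¬ DifferentiableAt ℝ (fun x => (u x).toReal) x) := by
    refine measure_eq_zero_iff_ae_notMem.1 (measure_null_of_locally_null {x |
      x ∈ interior {x | u x < ⊤} ∧ ¬ DifferentiableAt ℝ (fun x => (u x).toReal) x} ?_)
    rintro x ⟨hx, -⟩
    obtain ⟨K, t, ht, hK⟩ := hu.convexOn_toReal.locallyLipschitzOn_interior hx
    rw [isOpen_interior.nhdsWithin_eq hx] at ht
    refine ⟨interior t ∩ {x | x ∈ interior {x | u x < ⊤} ∧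
      ¬ DifferentiableAt ℝ (fun x => (u x).toReal) x}, ?_, ?_⟩
    · rw [Set.inter_comm]
      exact inter_mem_nhdsWithin _ (interior_mem_nhds.2 ht)
    · rw [measure_eq_zero_iff_ae_notMem]
      filter_upwards [hK.ae_differentiableWithinAt_of_mem] with y hy hy2
      exact hy2.2.2 ((hy (interior_subset hy2.1)).differentiableAt
        (mem_interior_iff_mem_nhds.1 hy2.1))
  filter_upwards [hfr, hdiff] with x h1 h2 hx
  have hxi : x ∈ interior {x | u x < ⊤} := by
    by_contra h
    exact h1 ⟨subset_closure hx, h⟩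
  refine ⟨hxi, DifferentiableAt.hasGradientAt ?_⟩
  by_contra h
  exact h2 ⟨hxi, h⟩

section Pushforward

variable {d : ℕ} {μ : Measure (Ed d)} {f ψ : Ed d → ℝ≥0∞}

/-- The measure with density `e^{-f*}`. -/
def gibbsMeasure (f : Ed d → ℝ≥0∞) : Measure (Ed d) :=
  volume.withDensity fun x => expNeg (posConj f x)

lemma gibbsMeasure_univ (f : Ed d → ℝ≥0∞) : gibbsMeasure f Set.univ = gibbsMass f := by
  rw [gibbsMeasure, withDensity_apply _ MeasurableSet.univ, setLIntegral_univ, gibbsMass]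

lemma measurableSet_posConj_lt_top (f : Ed d → ℝ≥0∞) : MeasurableSet {x | posConj f x < ⊤} :=
  measurable_posConj f measurableSet_Iio

lemma lintegral_map_gradient (f : Ed d → ℝ≥0∞) (hψ : Measurable ψ) :
    ∫⁻ y, ψ y ∂((gibbsMeasure f).map (gradient fun x => (posConj f x).toReal)) =
      ∫⁻ x in {x | posConj f x < ⊤},
        ψ (gradient (fun x => (posConj f x).toReal) x) * expNeg (posConj f x) := by
  have hG := measurable_gradient fun x : Ed d => (posConj f x).toReal
  rw [lintegral_map hψ hG, gibbsMeasure, lintegral_withDensity_eq_lintegral_mul _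
    (show Measurable fun x => expNeg (posConj f x) from
      measurable_expNeg.comp (measurable_posConj f))
    (show Measurable fun x => ψ (gradient (fun x => (posConj f x).toReal) x) from hψ.comp hG),
    ← lintegral_indicator (measurableSet_posConj_lt_top f)]
  refine lintegral_congr fun x => ?_
  by_cases hx : posConj f x < ⊤
  · simp [Set.indicator, hx, mul_comm]
  · simp [Set.indicator, not_lt_top_iff.1 hx]

lemma lintegral_map_gradient_le_liminf (f : Ed d → ℝ≥0∞) (hψ : LowerSemicontinuous ψ) :
    ∫⁻ y, ψ y ∂((gibbsMeasure f).map (gradient fun x => (posConj f x).toReal)) ≤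
      liminf (fun t => ∫⁻ x in {x | posConj f x < ⊤}, gibbsQuotient f ψ t x) (𝓝[>] 0) := by
  rw [lintegral_map_gradient f hψ.measurable]
  refine le_trans ?_ (lintegral_liminf_le fun t => measurable_gibbsQuotient f ψ t)
  refine lintegral_mono_ae ?_
  rw [ae_restrict_iff' (measurableSet_posConj_lt_top f)]
  filter_upwards [(ennConvex_posConj f).ae_hasGradientAt] with x hx hxt
  exact mul_expNeg_le_liminf_gibbsQuotient (hx hxt).1 (hx hxt).2 (hψ _)

lemma lintegral_map_gradient_le (hf : IsMomentMaximizer μ f) (hψ : LowerSemicontinuous ψ) :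
    ∫⁻ y, ψ y ∂((gibbsMeasure f).map (gradient fun x => (posConj f x).toReal)) ≤
      gibbsMass f * ∫⁻ y, ψ y ∂μ := by
  refine (lintegral_map_gradient_le_liminf f hψ).trans (le_trans ?_
    (limsup_lintegral_gibbsQuotient_le hf hψ.measurable))
  refine (liminf_le_limsup).trans (limsup_le_limsup (Eventually.of_forall fun t => ?_))
  exact setLIntegral_le_lintegral _ _

theorem map_gradient_gibbsMeasure [IsProbabilityMeasure μ] (hf : IsMomentMaximizer μ f) :
    (gibbsMeasure f).map (gradient fun x => (posConj f x).toReal) = gibbsMass f • μ := by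
  have hG := measurable_gradient fun x : Ed d => (posConj f x).toReal
  have huniv : (gibbsMeasure f).map (gradient fun x => (posConj f x).toReal) Set.univ =
      (gibbsMass f • μ) Set.univ := by
    rw [Measure.map_apply hG MeasurableSet.univ, Set.preimage_univ, gibbsMeasure_univ]
    simp
  have hfin : IsFiniteMeasure (gibbsMass f • μ) :=
    ⟨by simpa using hf.gibbsMass_ne_top.lt_top⟩
  have : IsFiniteMeasure ((gibbsMeasure f).map (gradient fun x => (posConj f x).toReal)) :=
    ⟨by rw [huniv]; exact measure_lt_top _ _⟩
  refine Measure.eq_of_le_of_measure_univ_eq ?_ huniv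
  refine Measure.le_iff.2 fun s _ => ?_
  rw [Set.measure_eq_iInf_isOpen s (gibbsMass f • μ)]
  refine le_iInf₂ fun U hU => le_iInf fun hUo => (measure_mono hU).trans ?_
  have h1 := lintegral_map_gradient_le hf (hUo.lowerSemicontinuous_indicator (y := (1 : ℝ≥0∞)) zero_le_one)
  rw [lintegral_indicator_const hUo.measurableSet, lintegral_indicator_const hUo.measurableSet] at h1
  simpa using h1

/-- No mass is produced outside the domain at first order. -/
theorem liminf_setLIntegral_gibbsQuotient_eq_zero [IsProbabilityMeasure μ]
    (hf : IsMomentMaximizer μ f) (hψ : LowerSemicontinuous ψ) (hψμ : ∫⁻ y, ψ y ∂μ ≠ ⊤) :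
    liminf (fun t => ∫⁻ x in {x | posConj f x < ⊤}ᶜ, gibbsQuotient f ψ t x) (𝓝[>] 0) = 0 := by
  have h1 := lintegral_map_gradient_le_liminf f hψ
  rw [map_gradient_gibbsMeasure hf, lintegral_smul_measure, smul_eq_mul] at h1
  have h2 : liminf (fun t => ∫⁻ x in {x | posConj f x < ⊤}, gibbsQuotient f ψ t x) (𝓝[>] 0) +
      liminf (fun t => ∫⁻ x in {x | posConj f x < ⊤}ᶜ, gibbsQuotient f ψ t x) (𝓝[>] 0) ≤
      gibbsMass f * ∫⁻ y, ψ y ∂μ := by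
    refine (ENNReal_add_liminf_le _ _ _).trans ?_
    refine le_trans ?_ (limsup_lintegral_gibbsQuotient_le hf hψ.measurable)
    refine le_trans (liminf_le_liminf (Eventually.of_forall fun t => ?_)) liminf_le_limsup
    exact (lintegral_add_compl _ (measurableSet_posConj_lt_top f)).le
  have h3 := (add_le_add_left h1 _).trans h2
  have hK : gibbsMass f * ∫⁻ y, ψ y ∂μ ≠ ⊤ := ENNReal.mul_ne_top hf.gibbsMass_ne_top hψμ
  simpa using (ENNReal.add_le_add_iff_left hK).1 (h3.trans_eq (add_zero _).symm)

end Pushforward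

section EssentialContinuity

/-- Next to every boundary point of a convex body there is a ball of comparable size outside
of it. -/
lemma Convex.exists_ball_subset_compl {E : Type*} [NormedAddCommGroup E] [InnerProductSpace ℝ E]
    [CompleteSpace E] {D : Set E} (hD : Convex ℝ D) (hne : (interior D).Nonempty) {a : E}
    (ha : a ∈ frontier D) {t : ℝ} (ht : 0 < t) :
    ∃ c, Metric.ball c (t / 2) ⊆ Metric.closedBall a t ∩ Dᶜ := by
  obtain ⟨φ, hφ⟩ := geometric_hahn_banach_open_point hD.interior isOpen_interior ha.2
  obtain ⟨p, hp⟩ := hne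
  set v := (InnerProductSpace.toDual ℝ E).symm φ with hv
  have hvφ : ∀ x, ⟪v, x⟫ = φ x := fun x => InnerProductSpace.toDual_symm_apply
  have hv0 : 0 < ‖v‖ := by
    rw [norm_pos_iff]
    intro h
    have h1 := hφ p hp
    rw [← hvφ, ← hvφ, h] at h1
    simp at h1
  have hsub : D ⊆ {x | φ x ≤ φ a} := by
    have h1 : interior D ⊆ {x | φ x ≤ φ a} := fun x hx => (hφ x hx).le
    have h2 : IsClosed {x | φ x ≤ φ a} := isClosed_le φ.continuous continuous_const
    refine subset_closure.trans ?_
    rw [← hD.closure_interior_eq_closure_of_nonempty_interior ⟨p, hp⟩]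
    exact h2.closure_subset_iff.2 h1
  set w := (t / 2 / ‖v‖) • v with hw
  have hwn : ‖w‖ = t / 2 := by
    rw [hw, norm_smul, Real.norm_of_nonneg (by positivity)]
    field_simp
  refine ⟨a + w, fun x hx => ⟨?_, fun hxD => ?_⟩⟩
  · rw [mem_ball_iff_norm] at hx
    rw [mem_closedBall_iff_norm]
    calc ‖x - a‖ = ‖(x - (a + w)) + w‖ := by congr 1; abel
      _ ≤ ‖x - (a + w)‖ + ‖w‖ := norm_add_le _ _
      _ ≤ t := by linarith
  · rw [mem_ball_iff_norm] at hx
    have h1 : φ x ≤ φ a := hsub hxD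
    have h2 := real_inner_le_norm v ((a + w) - x)
    rw [norm_sub_rev] at h2
    have h3 : ⟪v, w⟫ = t / 2 * ‖v‖ := by
      rw [hw, real_inner_smul_right, real_inner_self_eq_norm_sq]
      field_simp
    rw [inner_sub_right, inner_add_right, h3, hvφ, hvφ] at h2
    nlinarith

lemma ediam_closedBall_five_mul_le {E : Type*} [PseudoMetricSpace E] (b : E) {t : ℝ}
    (ht : 0 ≤ t) : Metric.ediam (Metric.closedBall b (5 * t)) ≤ ENNReal.ofReal (10 * t) := by
  rw [← Metric.closedEBall_ofReal (by positivity)]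
  refine Metric.ediam_closedEBall_le.trans_eq ?_
  rw [show (2 : ℝ≥0∞) = ENNReal.ofReal 2 by simp, ← ENNReal.ofReal_mul (by norm_num)]
  congr 1
  ring

/-- A cover of a piece of the boundary of a convex body, controlled by the volume of the outer
tube around this piece. -/
lemma Convex.exists_cover_frontier {n : ℕ} {D : Set (Ed (n + 1))} (hD : Convex ℝ D)
    (hne : (interior D).Nonempty) {F : Set (Ed (n + 1))} (hF : F ⊆ frontier D) {t : ℝ}
    (ht : 0 < t) :
    ∃ S : Set (Ed (n + 1)), S.Countable ∧ F ⊆ ⋃ b : S, Metric.closedBall (b : Ed (n + 1)) (5 * t) ∧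
      ∑' b : S, Metric.ediam (Metric.closedBall (b : Ed (n + 1)) (5 * t)) ^ (((n + 1 : ℕ) : ℝ) - 1) ≤
        ENNReal.ofReal (10 ^ n * 2 ^ (n + 1)) / volume (Metric.ball (0 : Ed (n + 1)) 1) *
          (ENNReal.ofReal t⁻¹ * volume ((⋃ a ∈ F, Metric.closedBall a t) ∩ Dᶜ)) := by
  obtain ⟨S, hSF, hdisj, hcov⟩ := Vitali.exists_disjoint_subfamily_covering_enlargement_closedBall
    F id (fun _ => t) t (fun _ _ => le_rfl) 5 (by norm_num)
  have hScount : S.Countable := hdisj.countable_of_nonempty_interior fun a _ =>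
    ⟨a, mem_interior_iff_mem_nhds.2 (Metric.closedBall_mem_nhds a ht)⟩
  have hvol0 : volume (Metric.ball (0 : Ed (n + 1)) 1) ≠ 0 :=
    (Metric.measure_ball_pos _ _ one_pos).ne'
  have hvolt : volume (Metric.ball (0 : Ed (n + 1)) 1) ≠ ⊤ := measure_ball_lt_top.ne
  refine ⟨S, hScount, fun a ha => ?_, ?_⟩
  · obtain ⟨b, hb, hab⟩ := hcov a ha
    exact Set.mem_iUnion.2 ⟨⟨b, hb⟩, hab (Metric.mem_closedBall_self ht.le)⟩
  choose! c hc using fun a (ha : a ∈ S) => hD.exists_ball_subset_compl hne (hF (hSF ha)) ht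
  have hsum : ∑' b : S, volume (Metric.ball (c b) (t / 2)) ≤
      volume ((⋃ a ∈ F, Metric.closedBall a t) ∩ Dᶜ) := by
    have := hScount.to_subtype
    rw [← measure_iUnion]
    · refine measure_mono (Set.iUnion_subset fun b x hx => ⟨?_, (hc b b.2 hx).2⟩)
      exact Set.mem_biUnion (hSF b.2) (hc b b.2 hx).1
    · intro b b' hbb'
      refine (hdisj b.2 b'.2 fun h => hbb' (Subtype.ext h)).mono ?_ ?_
      · exact fun x hx => (hc b b.2 hx).1
      · exact fun x hx => (hc b' b'.2 hx).1
    · exact fun b => measurableSet_ball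
  calc _ ≤ ∑' b : S, ENNReal.ofReal (10 ^ n * 2 ^ (n + 1)) /
        volume (Metric.ball (0 : Ed (n + 1)) 1) *
          (ENNReal.ofReal t⁻¹ * volume (Metric.ball (c b) (t / 2))) := by
        refine ENNReal.tsum_le_tsum fun b => ?_
        rw [show (((n + 1 : ℕ) : ℝ) - 1) = n by push_cast; ring, ENNReal.rpow_natCast,
          Measure.addHaar_ball volume (c b) (show 0 ≤ t / 2 by positivity),
          finrank_euclideanSpace, Fintype.card_fin]
        calc _ ≤ ENNReal.ofReal (10 * t) ^ n :=
              pow_le_pow_left' (ediam_closedBall_five_mul_le _ ht.le) n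
          _ = ENNReal.ofReal (10 ^ n * 2 ^ (n + 1)) * (ENNReal.ofReal t⁻¹ *
              ENNReal.ofReal ((t / 2) ^ (n + 1))) := by
            rw [← ENNReal.ofReal_pow (by positivity), ← ENNReal.ofReal_mul (by positivity),
              ← ENNReal.ofReal_mul (by positivity)]
            congr 1
            rw [mul_pow, div_pow, pow_succ t]
            field_simp
          _ = _ := by
            rw [mul_comm (ENNReal.ofReal ((t / 2) ^ (n + 1))), mul_left_comm _ (volume _),
              ← mul_assoc (_ / _), ENNReal.div_mul_cancel hvol0 hvolt]
    _ = ENNReal.ofReal (10 ^ n * 2 ^ (n + 1)) / volume (Metric.ball (0 : Ed (n + 1)) 1) *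
          (ENNReal.ofReal t⁻¹ * ∑' b : S, volume (Metric.ball (c b) (t / 2))) := by
        rw [ENNReal.tsum_mul_left, ENNReal.tsum_mul_left]
    _ ≤ _ := by gcongr

lemma posConj_add_mul_norm_le {d : ℕ} (f : Ed d → ℝ≥0∞) {a x : Ed d} {t : ℝ}
    (hx : x ∈ Metric.closedBall a t) :
    posConj (fun y => f y + ENNReal.ofReal t * ‖y‖ₑ) x ≤ posConj f a := by
  rw [mem_closedBall_iff_norm] at hx
  rw [posConj_le_iff]
  intro y
  calc ENNReal.ofReal ⟪x, y⟫ ≤ ENNReal.ofReal (⟪a, y⟫ + t * ‖y‖) := by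
        apply ENNReal.ofReal_le_ofReal
        have h1 := real_inner_le_norm (x - a) y
        rw [inner_sub_left] at h1
        have h2 : ‖x - a‖ * ‖y‖ ≤ t * ‖y‖ := by gcongr
        linarith
    _ ≤ ENNReal.ofReal ⟪a, y⟫ + ENNReal.ofReal t * ‖y‖ₑ := by
        rw [← ofReal_norm, ← ENNReal.ofReal_mul ((norm_nonneg _).trans hx)]
        exact ENNReal.ofReal_add_le
    _ ≤ posConj f a + f y + ENNReal.ofReal t * ‖y‖ₑ := by
        gcongr
        exact ofReal_inner_le_posConj_add f a y
    _ = _ := by ring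

lemma mul_volume_tube_le {d : ℕ} (f : Ed d → ℝ≥0∞) {F : Set (Ed d)} {M : ℝ≥0∞}
    (hF : ∀ a ∈ F, posConj f a ≤ M) (t : ℝ) :
    ENNReal.ofReal t⁻¹ * expNeg M *
        volume ((⋃ a ∈ F, Metric.closedBall a t) ∩ {x | posConj f x < ⊤}ᶜ) ≤
      ∫⁻ x in {x | posConj f x < ⊤}ᶜ, gibbsQuotient f (fun y => ‖y‖ₑ) t x := by
  refine le_trans ?_ (mul_meas_ge_le_lintegral (measurable_gibbsQuotient f _ t)
    (ENNReal.ofReal t⁻¹ * expNeg M))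
  refine mul_le_mul' le_rfl ?_
  rw [Measure.restrict_apply' (measurableSet_posConj_lt_top f).compl]
  refine measure_mono fun x hx => ⟨?_, hx.2⟩
  obtain ⟨a, ha, hxa⟩ := Set.mem_iUnion₂.1 hx.1
  have hxt : posConj f x = ⊤ := not_lt_top_iff.1 hx.2
  show ENNReal.ofReal t⁻¹ * expNeg M ≤ gibbsQuotient f (fun y => ‖y‖ₑ) t x
  rw [gibbsQuotient, hxt, expNeg_top, tsub_zero]
  gcongr
  rw [expNeg_le_expConj_iff]
  exact (posConj_add_mul_norm_le f hxa).trans (hF a ha)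

lemma interior_posConj_lt_top_nonempty {d : ℕ} {f : Ed d → ℝ≥0∞} (hf : gibbsMass f ≠ 0) :
    (interior {x | posConj f x < ⊤}).Nonempty := by
  by_contra! h
  apply hf
  rw [gibbsMass, lintegral_eq_zero_iff (show Measurable fun x => expNeg (posConj f x) from
    measurable_expNeg.comp (measurable_posConj f))]
  filter_upwards [(ennConvex_posConj f).ae_hasGradientAt] with x hx
  by_contra hx0
  have hxt : posConj f x < ⊤ := by
    rw [lt_top_iff_ne_top]
    intro hxt
    exact hx0 (by simp [hxt])
  exact (h ▸ (hx hxt).1 : x ∈ (∅ : Set (Ed d)))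

theorem hausdorffMeasure_frontier_lt_top_eq_zero {n : ℕ} {μ : Measure (Ed (n + 1))}
    [IsProbabilityMeasure μ] (hμ1 : FirstMoment μ) {f : Ed (n + 1) → ℝ≥0∞}
    (hf : IsMomentMaximizer μ f) :
    μH[((n + 1 : ℕ) : ℝ) - 1]
      {x | x ∈ frontier {x | posConj f x < ⊤} ∧ posConj f x < ⊤} = 0 := by
  have hunion : {x | x ∈ frontier {x | posConj f x < ⊤} ∧ posConj f x < ⊤} ⊆
      ⋃ k : ℕ, {x | x ∈ frontier {x | posConj f x < ⊤} ∧ posConj f x ≤ k} := by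
    rintro x ⟨hx, hxt⟩
    obtain ⟨k, hk⟩ := ENNReal.exists_nat_gt hxt.ne
    exact Set.mem_iUnion.2 ⟨k, hx, hk.le⟩
  refine measure_mono_null hunion (measure_iUnion_null fun k => ?_)
  set F := {x | x ∈ frontier {x | posConj f x < ⊤} ∧ posConj f x ≤ k} with hF
  have hψμ : ∫⁻ y, ‖y‖ₑ ∂μ ≠ ⊤ := by
    have h1 : Integrable (fun y : Ed (n + 1) => ‖y‖) μ := hμ1
    simpa using h1.2.ne
  have hlim := liminf_setLIntegral_gibbsQuotient_eq_zero hf (ψ := fun y => ‖y‖ₑ)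
    continuous_enorm.lowerSemicontinuous hψμ
  set q := fun t : ℝ => ∫⁻ x in {x | posConj f x < ⊤}ᶜ, gibbsQuotient f (fun y => ‖y‖ₑ) t x
  have hex : ∀ j : ℕ, ∃ t : ℝ, 0 < t ∧ t ≤ 1 / ((j : ℝ) + 1) ∧ q t ≤ ((j : ℝ≥0∞) + 1)⁻¹ := by
    intro j
    have h1 : ∃ᶠ t in 𝓝[>] 0, q t < ((j : ℝ≥0∞) + 1)⁻¹ :=
      frequently_lt_of_liminf_lt (by isBoundedDefault) (by
        change liminf q _ < _
        rw [hlim]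
        simp)
    have h2 : ∀ᶠ t in 𝓝[>] (0 : ℝ), t < 1 / ((j : ℝ) + 1) :=
      nhdsWithin_le_nhds (gt_mem_nhds (by positivity))
    obtain ⟨t, ht1, ht2, ht3⟩ := (h1.and_eventually (h2.and self_mem_nhdsWithin)).exists
    exact ⟨t, ht3, ht2.le, ht1.le⟩
  choose t ht0 htj hq using hex
  have hne := interior_posConj_lt_top_nonempty hf.gibbsMass_ne_zero
  choose S hScount hScov hSsum using fun j => (ennConvex_posConj f).convex_lt_top.exists_cover_frontier
    hne (F := F) (fun _ h => h.1) (ht0 j)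
  have : ∀ j, Countable (S j) := fun j => (hScount j).to_subtype
  set C := ENNReal.ofReal (10 ^ n * 2 ^ (n + 1)) / volume (Metric.ball (0 : Ed (n + 1)) 1) with hC
  have hCt : C ≠ ⊤ := ENNReal.div_ne_top ENNReal.ofReal_ne_top
    (Metric.measure_ball_pos _ _ one_pos).ne'
  have hk0 : expNeg (k : ℝ≥0∞) ≠ 0 := by simp [expNeg_eq_zero_iff]
  have hbound : ∀ j, ∑' b : S j, Metric.ediam
      (Metric.closedBall (b : Ed (n + 1)) (5 * t j)) ^ (((n + 1 : ℕ) : ℝ) - 1) ≤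
      C * (expNeg k)⁻¹ * ((j : ℝ≥0∞) + 1)⁻¹ := by
    intro j
    refine (hSsum j).trans ?_
    rw [mul_assoc]
    refine mul_le_mul' le_rfl ?_
    have h1 := (mul_volume_tube_le f (fun a (ha : a ∈ F) => ha.2) (t j)).trans (hq j)
    rw [mul_comm _ (expNeg k), mul_assoc] at h1
    calc _ = (expNeg k)⁻¹ * (expNeg k * (ENNReal.ofReal (t j)⁻¹ *
          volume ((⋃ a ∈ F, Metric.closedBall a (t j)) ∩ {x | posConj f x < ⊤}ᶜ))) := by
          rw [← mul_assoc, ENNReal.inv_mul_cancel hk0 (expNeg_ne_top _), one_mul]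
      _ ≤ _ := mul_le_mul' le_rfl h1
  have hinv : Tendsto (fun j : ℕ => ((j : ℝ≥0∞) + 1)⁻¹) atTop (𝓝 0) := by
    have h1 := (tendsto_add_atTop_iff_nat 1).2 ENNReal.tendsto_inv_nat_nhds_zero
    simpa using h1
  have hb0 : Tendsto (fun j : ℕ => C * (expNeg k)⁻¹ * ((j : ℝ≥0∞) + 1)⁻¹) atTop (𝓝 0) := by
    simpa using ENNReal.Tendsto.const_mul hinv
      (Or.inr (ENNReal.mul_ne_top hCt (ENNReal.inv_ne_top.2 hk0)))
  have hr : Tendsto (fun j => ENNReal.ofReal (10 * t j)) atTop (𝓝 0) := by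
    have h1 : Tendsto t atTop (𝓝 0) := squeeze_zero (fun j => (ht0 j).le) htj
      tendsto_one_div_add_atTop_nhds_zero_nat
    simpa using ENNReal.tendsto_ofReal (h1.const_mul 10)
  have hH := Measure.hausdorffMeasure_le_liminf_tsum (((n + 1 : ℕ) : ℝ) - 1) F _ hr
    (fun j (b : S j) => Metric.closedBall (b : Ed (n + 1)) (5 * t j))
    (Eventually.of_forall fun j b => ediam_closedBall_five_mul_le _ (ht0 j).le) (Eventually.of_forall hScov)
  refine le_antisymm (hH.trans ?_) bot_le
  rw [← hb0.liminf_eq]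
  exact liminf_le_liminf (Eventually.of_forall hbound)

end EssentialContinuity

section Potential

/-- The potential `f* + log Z`, where `Z` is the mass of `e^{-f*}`. -/
def normalizedPotential {d : ℕ} (f : Ed d → ℝ≥0∞) (x : Ed d) : EReal :=
  (posConj f x : EReal) + (Real.log (gibbsMass f).toReal : EReal)

variable {d : ℕ} {f : Ed d → ℝ≥0∞}

lemma normalizedPotential_eq_top_iff {x : Ed d} :
    normalizedPotential f x = ⊤ ↔ posConj f x = ⊤ := by
  rw [normalizedPotential]
  constructor
  · intro h
    by_contra hx
    lift posConj f x to NNReal using hx with p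
    exact EReal.coe_ne_top (p + Real.log (gibbsMass f).toReal) h
  · intro h
    rw [h]
    rfl

lemma normalizedPotential_lt_top_iff {x : Ed d} :
    normalizedPotential f x < ⊤ ↔ posConj f x < ⊤ := by
  rw [lt_top_iff_ne_top, lt_top_iff_ne_top, ne_eq, ne_eq, normalizedPotential_eq_top_iff]

lemma normalizedPotential_ne_bot (x : Ed d) : normalizedPotential f x ≠ ⊥ := by
  rw [normalizedPotential, ne_eq, EReal.add_eq_bot_iff]
  simp

lemma toReal_normalizedPotential {x : Ed d} (hx : posConj f x ≠ ⊤) :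
    (normalizedPotential f x).toReal = (posConj f x).toReal + Real.log (gibbsMass f).toReal := by
  rw [normalizedPotential]
  lift posConj f x to NNReal using hx with p
  exact EReal.toReal_coe (p + Real.log (gibbsMass f).toReal)

lemma eConvexOn_normalizedPotential : EConvexOn (normalizedPotential f) := by
  intro x y a b ha hb hab
  have hxy := ennConvex_posConj f x y a b ha hb hab
  rw [normalizedPotential, normalizedPotential, normalizedPotential]
  set c := Real.log (gibbsMass f).toReal
  have hmul : ∀ (s : ℝ) (p : ℝ≥0∞), 0 ≤ s →
      (s : EReal) * ((p : EReal) + c) = ((ENNReal.ofReal s * p : ℝ≥0∞) : EReal) + (s * c : ℝ) := by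
    intro s p hs
    rw [EReal.coe_ennreal_mul, EReal.coe_ennreal_ofReal, max_eq_left hs,
      EReal.left_distrib_of_nonneg_of_ne_top (by exact_mod_cast hs) (EReal.coe_ne_top _),
      EReal.coe_mul]
  rw [hmul a _ ha, hmul b _ hb, add_add_add_comm, ← EReal.coe_add, ← add_mul, hab, one_mul,
    ← EReal.coe_ennreal_add]
  gcongr
  exact EReal.coe_ennreal_le_coe_ennreal_iff.2 hxy

lemma lowerSemicontinuous_normalizedPotential : LowerSemicontinuous (normalizedPotential f) := by
  have h1 : LowerSemicontinuous fun x => (posConj f x : EReal) :=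
    continuous_coe_ennreal_ereal.comp_lowerSemicontinuous (lowerSemicontinuous_posConj f)
      EReal.coe_ennreal_strictMono.monotone
  refine h1.add' lowerSemicontinuous_const fun x => ?_
  exact EReal.continuousAt_add (Or.inr (EReal.coe_ne_bot _)) (Or.inr (EReal.coe_ne_top _))

lemma ofReal_expNegE_normalizedPotential (h0 : gibbsMass f ≠ 0) (ht : gibbsMass f ≠ ⊤)
    (x : Ed d) :
    ENNReal.ofReal (expNegE (normalizedPotential f x)) = (gibbsMass f)⁻¹ * expNeg (posConj f x) := by
  rw [expNegE]
  split_ifs with h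
  · rw [normalizedPotential_eq_top_iff.1 h]
    simp
  · rw [normalizedPotential_eq_top_iff] at h
    have hpos := ENNReal.toReal_pos h0 ht
    rw [toReal_normalizedPotential h, expNeg_of_ne_top h, neg_add, add_comm, Real.exp_add,
      Real.exp_neg (Real.log _), Real.exp_log hpos, ENNReal.ofReal_mul (by positivity),
      ENNReal.ofReal_inv_of_pos hpos, ENNReal.ofReal_toReal ht]

lemma integral_expNegE_normalizedPotential (h0 : gibbsMass f ≠ 0) (ht : gibbsMass f ≠ ⊤) :
    ∫ x, expNegE (normalizedPotential f x) = 1 := by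
  have hnonneg : ∀ x, 0 ≤ expNegE (normalizedPotential f x) := by
    intro x
    rw [expNegE]
    positivity
  have hp := measurable_posConj f
  have hmeas : Measurable fun x => expNegE (normalizedPotential f x) := by
    have h1 : Measurable fun x => ((gibbsMass f)⁻¹ * expNeg (posConj f x)).toReal :=
      ((measurable_expNeg.comp hp).const_mul _).ennreal_toReal
    convert h1 using 2 with x
    rw [← ofReal_expNegE_normalizedPotential h0 ht, ENNReal.toReal_ofReal (hnonneg x)]
  rw [integral_eq_lintegral_of_nonneg_ae (Eventually.of_forall hnonneg)
    hmeas.aestronglyMeasurable]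
  simp_rw [ofReal_expNegE_normalizedPotential h0 ht]
  rw [lintegral_const_mul _ (show Measurable fun x => expNeg (posConj f x) from
    measurable_expNeg.comp hp), ← gibbsMass, ENNReal.inv_mul_cancel h0 ht, ENNReal.toReal_one]

lemma withDensity_expNegE_normalizedPotential (h0 : gibbsMass f ≠ 0) (ht : gibbsMass f ≠ ⊤) :
    volume.withDensity (fun x => ENNReal.ofReal (expNegE (normalizedPotential f x))) =
      (gibbsMass f)⁻¹ • gibbsMeasure f := by
  simp_rw [ofReal_expNegE_normalizedPotential h0 ht]
  exact withDensity_smul _ (measurable_expNeg.comp (measurable_posConj f))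

lemma ae_gradient_normalizedPotential_eq :
    gradient (fun x => (normalizedPotential f x).toReal) =ᵐ[gibbsMeasure f]
      gradient fun x => (posConj f x).toReal := by
  rw [EventuallyEq, gibbsMeasure, ae_withDensity_iff
    (show Measurable fun x => expNeg (posConj f x) from
      measurable_expNeg.comp (measurable_posConj f))]
  filter_upwards [(ennConvex_posConj f).ae_hasGradientAt] with x hx hx0
  obtain ⟨hint, hgrad⟩ := hx (lt_top_iff_ne_top.2 fun h => hx0 (by simp [h]))
  have heq : (fun y => (normalizedPotential f y).toReal) =ᶠ[𝓝 x]
      fun y => (posConj f y).toReal + Real.log (gibbsMass f).toReal := by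
    filter_upwards [mem_interior_iff_mem_nhds.1 hint] with y hy
    exact toReal_normalizedPotential (ne_of_lt hy)
  refine HasGradientAt.gradient (HasGradientAt.congr_of_eventuallyEq ?_ heq)
  rw [hasGradientAt_iff_hasFDerivAt] at hgrad ⊢
  exact hgrad.add_const _

end Potential

/-- every centered measure `μ ∈ P_1(ℝ^d)` not supported on an affine hyperplane
is a moment measure: `μ = (∇u)_#(e^{-u} dx)` for an essentially continuous convex function. -/
theorem is_moment_measure {d : ℕ} (hd : 1 ≤ d)
    (μ : Measure (Ed d)) [IsProbabilityMeasure μ] (hμ1 : FirstMoment μ) (hμc : Centered μ)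
    (hμH : ¬ ∃ e : Ed d, ∃ ℓ : ℝ, ‖e‖ = 1 ∧ μ {y | (⟪y, e⟫ : ℝ) = ℓ} = 1) :
    ∃ u : Ed d → EReal,
      (∀ x, u x ≠ ⊥) ∧ EConvexOn u ∧ LowerSemicontinuous u ∧ (∃ x, u x ≠ ⊤) ∧
      EssentiallyContinuous u ∧
      (∫ x : Ed d, expNegE (u x)) = 1 ∧
      (volume.withDensity (fun x => ENNReal.ofReal (expNegE (u x)))).map
          (fun x => gradient (fun y => (u y).toReal) x) = μ := by
  obtain ⟨n, rfl⟩ := Nat.exists_eq_add_of_le' hd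
  obtain ⟨f, hf⟩ := exists_isMomentMaximizer hμ1 hμc hμH
  have h0 := hf.gibbsMass_ne_zero
  have ht := hf.gibbsMass_ne_top
  refine ⟨normalizedPotential f, normalizedPotential_ne_bot, eConvexOn_normalizedPotential,
    lowerSemicontinuous_normalizedPotential, ⟨0, ?_⟩, ?_,
    integral_expNegE_normalizedPotential h0 ht, ?_⟩
  · rw [ne_eq, normalizedPotential_eq_top_iff, posConj_zero]
    exact ENNReal.zero_ne_top
  · simp only [EssentiallyContinuous, normalizedPotential_lt_top_iff]
    exact hausdorffMeasure_frontier_lt_top_eq_zero hμ1 hf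
  · rw [withDensity_expNegE_normalizedPotential h0 ht, Measure.map_smul,
      Measure.map_congr ae_gradient_normalizedPotential_eq, map_gradient_gibbsMeasure hf,
      smul_smul, ENNReal.inv_mul_cancel h0 ht, one_smul]
end
end

section
/- Let d ≥ 1 and suppose μ ∈ P_1(ℝ^d) is centered and supported on an affine hyperplane (there exist e ∈ ℝ^d with |e| = 1 and ℓ ∈ ℝ such that μ({y : ⟨y,e⟩ = ℓ}) = 1). Then inf{ E(ρ) + T(ρ,μ) : ρ ∈ P_1(ℝ^d) } = −∞; that is, for every M ∈ ℝ there exists ρ ∈ P_1(ℝ^d) with E(ρ) + T(ρ,μ) < −M. -/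
open MeasureTheory Real Filter Topology
open scoped ENNReal RealInnerProductSpace

noncomputable section

/-- The infinite cylinder with axis `e` and radius `1` in Euclidean space has infinite volume. -/
theorem volume_cylinder_eq_top {d : ℕ} {e : Ed d} (he : ‖e‖ = 1) :
    volume {x : Ed d | ‖x - (⟪x, e⟫ : ℝ) • e‖ ≤ 1} = ⊤ := by
  have hee : (⟪e, e⟫ : ℝ) = 1 := by rw [real_inner_self_eq_norm_sq, he]; norm_num
  have hsub : (⋃ k : ℕ, Metric.ball ((3 * k : ℝ) • e) 1) ⊆
      {x : Ed d | ‖x - (⟪x, e⟫ : ℝ) • e‖ ≤ 1} := by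
    refine Set.iUnion_subset fun k x hx ↦ ?_
    rw [mem_ball_iff_norm] at hx
    set w := x - (3 * k : ℝ) • e with hw
    have hx' : x = w + (3 * k : ℝ) • e := by simp [hw]
    have h1 : x - (⟪x, e⟫ : ℝ) • e = w - (⟪w, e⟫ : ℝ) • e := by
      rw [hx', inner_add_left, real_inner_smul_left, hee]
      module
    have h2 : ‖w - (⟪w, e⟫ : ℝ) • e‖ ^ 2 = ‖w‖ ^ 2 - (⟪w, e⟫ : ℝ) ^ 2 := by
      rw [norm_sub_sq_real, norm_smul, real_inner_smul_right, he, mul_one, Real.norm_eq_abs, sq_abs]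
      ring
    rw [Set.mem_ofPred_eq, h1]
    nlinarith [norm_nonneg w, norm_nonneg (w - (⟪w, e⟫ : ℝ) • e), sq_nonneg (⟪w, e⟫ : ℝ)]
  have hdisj : Pairwise (Function.onFun Disjoint
      fun k : ℕ ↦ Metric.ball ((3 * k : ℝ) • e) 1) := by
    intro i j hij
    refine Metric.ball_disjoint_ball ?_
    rw [dist_eq_norm, ← sub_smul, norm_smul, he, mul_one, Real.norm_eq_abs, ← mul_sub, abs_mul]
    have : (1 : ℝ) ≤ |(i : ℝ) - j| := by
      have : (1 : ℤ) ≤ |(i : ℤ) - j| := Int.one_le_abs (by omega)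
      exact_mod_cast this
    norm_num
    linarith
  refine top_le_iff.mp (le_trans (le_of_eq ?_) (measure_mono hsub))
  rw [measure_iUnion hdisj fun _ ↦ measurableSet_ball]
  simp_rw [Measure.addHaar_ball_center]
  exact (ENNReal.tsum_const_eq_top_of_ne_zero
    (Metric.measure_ball_pos volume (0 : Ed d) one_pos).ne').symm

/-- The entropy of the uniform distribution on a set of volume `V ≥ 1` is `-log V`. -/
theorem entropy_uniform {d : ℕ} {S : Set (Ed d)} (hS : MeasurableSet S)
    (h1 : 1 ≤ volume S) (htop : volume S ≠ ⊤) :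
    entropy ((volume S)⁻¹ • (volume.restrict S)) =
      ((-Real.log (volume S).toReal : ℝ) : EReal) := by
  set c : ℝ≥0∞ := (volume S)⁻¹
  have hrn : (c • (volume.restrict S)).rnDeriv volume =ᵐ[volume] S.indicator fun _ ↦ c := by
    rw [← withDensity_const, ← withDensity_indicator hS]
    exact Measure.rnDeriv_withDensity _ (measurable_const.indicator hS)
  have hac : c • (volume.restrict S) ≪ (volume : Measure (Ed d)) :=
    Measure.smul_absolutelyContinuous.trans Measure.absolutelyContinuous_restrict
  set V := (volume S).toReal with hV
  have hV1 : 1 ≤ V := by simpa using ENNReal.toReal_mono htop h1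
  have hlog : 0 ≤ Real.log V := Real.log_nonneg hV1
  have hcV : c.toReal = V⁻¹ := ENNReal.toReal_inv _
  have hpos : ∫⁻ x, ENNReal.ofReal (((c • (volume.restrict S)).rnDeriv volume x).toReal *
      Real.log ((c • (volume.restrict S)).rnDeriv volume x).toReal) = 0 := by
    rw [lintegral_eq_zero_iff' (by fun_prop)]
    filter_upwards [hrn] with x hx
    rw [hx]
    by_cases hxS : x ∈ S
    · simp only [Set.indicator_of_mem hxS, hcV, Real.log_inv, Pi.zero_apply,
        ENNReal.ofReal_eq_zero]
      have : 0 ≤ V⁻¹ := by positivity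
      nlinarith
    · simp [hxS]
  have hneg : ∫⁻ x, ENNReal.ofReal (-(((c • (volume.restrict S)).rnDeriv volume x).toReal *
      Real.log ((c • (volume.restrict S)).rnDeriv volume x).toReal)) =
        ENNReal.ofReal (Real.log V) := by
    have : ∀ᵐ x, ENNReal.ofReal (-(((c • (volume.restrict S)).rnDeriv volume x).toReal *
        Real.log ((c • (volume.restrict S)).rnDeriv volume x).toReal)) =
          S.indicator (fun _ ↦ ENNReal.ofReal (V⁻¹ * Real.log V)) x := by
      filter_upwards [hrn] with x hx
      rw [hx]
      by_cases hxS : x ∈ S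
      · simp [hxS, hcV]
      · simp [hxS]
    rw [lintegral_congr_ae this, lintegral_indicator_const hS, ← ENNReal.ofReal_toReal htop, ← hV,
      ← ENNReal.ofReal_mul (by positivity)]
    congr 1
    field_simp
  rw [entropy, if_pos hac, hpos, hneg, EReal.coe_ennreal_ofReal, max_eq_left hlog]
  simp

/-- If `μ` lives on the hyperplane orthogonal to `e` and `ρ` on the cylinder of axis `e` and
radius `1`, then their maximal correlation is at most the first moment of `μ`. -/
theorem maxCorr_le_of_cylinder {d : ℕ} {e : Ed d} {ρ μ : Measure (Ed d)}
    (hρ : ∀ᵐ x ∂ρ, ‖x - (⟪x, e⟫ : ℝ) • e‖ ≤ 1) (hμ : ∀ᵐ y ∂μ, (⟪y, e⟫ : ℝ) = 0) :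
    maxCorr ρ μ ≤ ((∫⁻ y, ENNReal.ofReal ‖y‖ ∂μ : ℝ≥0∞) : EReal) := by
  refine iSup₂_le fun γ hγ ↦ ?_
  obtain ⟨_, rfl, rfl⟩ := hγ
  have hx := ae_of_ae_map measurable_fst.aemeasurable hρ
  have hy := ae_of_ae_map measurable_snd.aemeasurable hμ
  have hle : ∫⁻ p, ENNReal.ofReal (⟪p.1, p.2⟫ : ℝ) ∂γ ≤ ∫⁻ y, ENNReal.ofReal ‖y‖ ∂γ.snd := by
    rw [Measure.snd, lintegral_map (by fun_prop) measurable_snd]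
    refine lintegral_mono_ae ?_
    filter_upwards [hx, hy] with p hp1 hp2
    refine ENNReal.ofReal_le_ofReal ?_
    have h : (⟪p.1, p.2⟫ : ℝ) = ⟪p.1 - (⟪p.1, e⟫ : ℝ) • e, p.2⟫ := by
      rw [inner_sub_left, real_inner_smul_left, real_inner_comm p.2 e, hp2]
      simp
    rw [h]
    exact (real_inner_le_norm _ _).trans (mul_le_of_le_one_left (norm_nonneg _) hp1)
  refine le_trans ?_ (EReal.coe_ennreal_le_coe_ennreal_iff.mpr hle)
  exact EReal.sub_le_of_le_add' (le_add_of_nonneg_left (EReal.coe_ennreal_nonneg _))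

/-- if `μ` is centered and supported on an affine hyperplane, then the infimum of
`E(·) + T(·,μ)` over `P_1(ℝ^d)` is `-∞`. -/
theorem inf_eq_bot_of_hyperplane {d : ℕ} (hd : 1 ≤ d)
    (μ : Measure (Ed d)) [IsProbabilityMeasure μ] (hμ1 : FirstMoment μ) (hμc : Centered μ)
    (hH : ∃ e : Ed d, ∃ ℓ : ℝ, ‖e‖ = 1 ∧ μ {y | (⟪y, e⟫ : ℝ) = ℓ} = 1) :
    ∀ M : ℝ, ∃ ρ : Measure (Ed d), IsProbabilityMeasure ρ ∧ FirstMoment ρ ∧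
      entropy ρ + maxCorr ρ μ < ((-M : ℝ) : EReal) := by
  obtain ⟨e, ℓ, he, hH⟩ := hH
  intro M
  have hℓ : ∀ᵐ y ∂μ, (⟪y, e⟫ : ℝ) = ℓ := by
    rw [ae_iff_prob_eq_one]
    · exact hH
    · exact (measurableSet_eq_fun (by fun_prop) measurable_const).mem
  have hint : Integrable (fun y : Ed d ↦ y) μ :=
    (integrable_norm_iff aestronglyMeasurable_id).mp hμ1
  have hℓ0 : ℓ = 0 := by
    have h1 : ∫ y, (⟪e, y⟫ : ℝ) ∂μ = ⟪e, ∫ y, y ∂μ⟫ := integral_inner hint e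
    have h2 : ∫ y, (⟪e, y⟫ : ℝ) ∂μ = ∫ _, ℓ ∂μ :=
      integral_congr_ae (hℓ.mono fun y hy ↦ (real_inner_comm _ _).trans hy)
    rw [show ∫ y, y ∂μ = 0 from hμc, inner_zero_right, h2] at h1
    simpa using h1
  subst hℓ0
  set C : ℝ := ∫ y, ‖y‖ ∂μ
  have hCeq : ∫⁻ y, ENNReal.ofReal ‖y‖ ∂μ = ENNReal.ofReal C :=
    (ofReal_integral_eq_lintegral_ofReal hμ1 (ae_of_all _ fun _ ↦ norm_nonneg _)).symm
  have hC0 : 0 ≤ C := integral_nonneg fun _ ↦ norm_nonneg _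
  set A : Set (Ed d) := {x | ‖x - (⟪x, e⟫ : ℝ) • e‖ ≤ 1}
  have hAm : MeasurableSet A := (isClosed_le (by fun_prop) continuous_const).measurableSet
  have hlim : Tendsto (fun n : ℕ ↦ volume (A ∩ Metric.closedBall 0 n)) atTop (𝓝 ⊤) := by
    have hmono : Monotone fun n : ℕ ↦ A ∩ Metric.closedBall (0 : Ed d) n := fun m n hmn ↦
      Set.inter_subset_inter_right _ (Metric.closedBall_subset_closedBall (by exact_mod_cast hmn))
    have := tendsto_measure_iUnion_atTop (μ := volume) hmono
    rwa [← Set.inter_iUnion, Metric.iUnion_closedBall_nat, Set.inter_univ,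
      volume_cylinder_eq_top he] at this
  obtain ⟨n, hn⟩ := (hlim.eventually_const_lt
    (ENNReal.ofReal_lt_top (r := max 1 (Real.exp (M + C))))).exists
  set S := A ∩ Metric.closedBall (0 : Ed d) n
  have hSm : MeasurableSet S := hAm.inter Metric.isClosed_closedBall.measurableSet
  have htop : volume S ≠ ⊤ :=
    ((measure_mono Set.inter_subset_right).trans_lt measure_closedBall_lt_top).ne
  have hexp := (ENNReal.ofReal_lt_iff_lt_toReal (by positivity) htop).mp hn
  have h1 : 1 ≤ volume S := by
    refine le_trans ?_ hn.le
    rw [ENNReal.one_le_ofReal]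
    exact le_max_left _ _
  have h0 : volume S ≠ 0 := (zero_lt_one.trans_le h1).ne'
  have haeS : ∀ᵐ x ∂((volume S)⁻¹ • (volume.restrict S)), x ∈ S :=
    Measure.ae_smul_measure (ae_restrict_mem hSm) _
  have hprob : IsProbabilityMeasure ((volume S)⁻¹ • (volume.restrict S)) :=
    ⟨by simp [ENNReal.inv_mul_cancel h0 htop]⟩
  refine ⟨(volume S)⁻¹ • (volume.restrict S), hprob, ?_, ?_⟩
  · refine Integrable.of_bound (by fun_prop) n (haeS.mono fun x hx ↦ ?_)
    simpa using hx.2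
  · have hT := maxCorr_le_of_cylinder (haeS.mono fun x hx ↦ hx.1) hℓ
    rw [hCeq, EReal.coe_ennreal_ofReal, max_eq_left hC0] at hT
    rw [entropy_uniform hSm h1 htop]
    refine (add_le_add_right hT _).trans_lt ?_
    rw [← EReal.coe_add, EReal.coe_lt_coe_iff]
    have : M + C < Real.log (volume S).toReal :=
      (Real.lt_log_iff_exp_lt (by linarith [le_max_left 1 (Real.exp (M + C))])).mpr
        ((le_max_right _ _).trans_lt hexp)
    linarith
end
end
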